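/- Fix integers n and k with 3 ≤ k ≤ n. Then: (1) for every integer i ≥ 0, the singular homology group H_i(M(𝓑_{n,k}); ℤ) is torsion free; and (2) for every integer i ≥ 1 that is not of the form t(k−2) for some integer t ≥ 1, the group H_i(M(𝓑_{n,k}); ℤ) is trivial. -/

import Mathlib

open CategoryTheory

/-- The singular chain complex of a topological space with `ℤ` coefficients. -/
noncomputable def singularChainComplex (X : TopCat) : ChainComplex (ModuleCat ℤ) ℕ :=
  (AlgebraicTopology.alternatingFaceMapComplex (ModuleCat ℤ)).obj
    (((SimplicialObject.whiskering _ _).obj (ModuleCat.free ℤ)).obj (TopCat.toSSet.obj X))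

/-- The `i`-th singular homology of a topological space with `ℤ` coefficients. -/
noncomputable def singularHomology (X : TopCat) (i : ℕ) : ModuleCat ℤ :=
  (singularChainComplex X).homology i

/-- The complement of the type-`B` `k`-parabolic arrangement `𝓑_{n,k}` in `ℝⁿ`:
points avoiding all subspaces `ε₁ x_{i₁} = ⋯ = ε_k x_{i_k}` (over `k`-subsets and sign
vectors) and all subspaces `x_{j₁} = ⋯ = x_{j_{k-1}} = 0` (over `(k-1)`-subsets). -/
def typeBComplement (n k : ℕ) : Set (Fin n → ℝ) :=
  {x | (∀ S : Finset (Fin n), S.card = k → ∀ ε : Fin n → ℝ, (∀ i, ε i = 1 ∨ ε i = -1) →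
          ¬ (∀ i ∈ S, ∀ j ∈ S, ε i * x i = ε j * x j)) ∧
       (∀ S : Finset (Fin n), S.card = k - 1 → ¬ (∀ i ∈ S, x i = 0))}

namespace TB

/-- Linear maps out of a free module: membership test on basis vectors of a supported submodule. -/
theorem supp_induct {α : Type*} {M : Type*} [AddCommGroup M] (L : (α →₀ ℤ) →ₗ[ℤ] M)
    (s : Set α) (N : Submodule ℤ M) (h : ∀ a ∈ s, L (Finsupp.single a 1) ∈ N)
    {x : α →₀ ℤ} (hx : x ∈ Finsupp.supported ℤ ℤ s) : L x ∈ N := by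
  rw [Finsupp.supported_eq_span_single] at hx
  have : Submodule.span ℤ ((fun i => Finsupp.single i (1:ℤ)) '' s) ≤ N.comap L := by
    rw [Submodule.span_le]
    rintro _ ⟨a, ha, rfl⟩
    exact h a ha
  exact this hx

theorem supp_eq {α : Type*} {M : Type*} [AddCommGroup M] (L L' : (α →₀ ℤ) →ₗ[ℤ] M)
    (s : Set α) (h : ∀ a ∈ s, L (Finsupp.single a 1) = L' (Finsupp.single a 1))
    {x : α →₀ ℤ} (hx : x ∈ Finsupp.supported ℤ ℤ s) : L x = L' x := by
  have := supp_induct (L - L') s ⊥ (fun a ha => by simp [h a ha]) hx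
  simpa [sub_eq_zero] using this

theorem lin_ext {α : Type*} {M : Type*} [AddCommGroup M] {L L' : (α →₀ ℤ) →ₗ[ℤ] M}
    (h : ∀ a, L (Finsupp.single a 1) = L' (Finsupp.single a 1)) (x : α →₀ ℤ) : L x = L' x :=
  supp_eq L L' Set.univ (fun a _ => h a) (by simp)

/-- Extend a function on a basis linearly. -/
noncomputable def lin {α : Type*} {M : Type*} [AddCommGroup M] (f : α → M) : (α →₀ ℤ) →ₗ[ℤ] M :=
  Finsupp.linearCombination ℤ f

@[simp] theorem lin_single {α : Type*} {M : Type*} [AddCommGroup M] (f : α → M) (a : α) :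
    lin f (Finsupp.single a 1) = f a := by simp [lin]

/-- Ordered (augmented) chains on a set. -/
abbrev A (K : Type) := List K →₀ ℤ

/-- Basis element. -/
noncomputable abbrev bs {α : Type*} (a : α) : α →₀ ℤ := Finsupp.single a 1

noncomputable def cone {K : Type} (b : K) : A K →ₗ[ℤ] A K := lin (fun l => bs (b :: l))

@[simp] theorem cone_bs {K : Type} (b : K) (l : List K) : cone b (bs l) = bs (b :: l) := by
  simp [cone]

noncomputable def bdL {K : Type} : List K → A K
  | [] => 0
  | b :: l => bs l - cone b (bdL l)

noncomputable def bd {K : Type} : A K →ₗ[ℤ] A K := lin bdL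

@[simp] theorem bd_bs {K : Type} (l : List K) : bd (bs l) = bdL l := by simp [bd]

theorem bd_cone {K : Type} (b : K) (c : A K) : bd (cone b c) = c - cone b (bd c) := by
  have := lin_ext (L := bd ∘ₗ cone b) (L' := LinearMap.id - cone b ∘ₗ bd)
    (fun l => by simp [bdL]) c
  simpa using this

theorem bd_bd {K : Type} (c : A K) : bd (bd c) = 0 := by
  refine lin_ext (L := bd ∘ₗ bd) (L' := 0) (fun l => ?_) c
  simp only [LinearMap.comp_apply, bd_bs, LinearMap.zero_apply]
  induction l with
  | nil => simp [bdL]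
  | cons b l ih => simp [bdL, bd_cone, ih]

/-- chains of lists of a given length -/
noncomputable def len (K : Type) (n : ℕ) : Submodule ℤ (A K) :=
  Finsupp.supported ℤ ℤ {l | l.length = n}

theorem cone_len {K : Type} (b : K) {n : ℕ} {c : A K} (hc : c ∈ len K n) :
    cone b c ∈ len K (n + 1) := by
  refine supp_induct _ _ _ (fun l hl => ?_) hc
  rw [cone_bs]
  exact Finsupp.single_mem_supported _ _ (by simpa using hl)

theorem bdL_len {K : Type} (b : K) (l : List K) : bdL (b :: l) ∈ len K l.length := by
  induction l generalizing b with
  | nil =>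
    simp only [bdL, map_zero, sub_zero]
    exact Finsupp.single_mem_supported _ _ rfl
  | cons a l ih =>
    rw [bdL]
    exact Submodule.sub_mem _ (Finsupp.single_mem_supported _ _ rfl) (cone_len _ (ih a))

/-- Members of the boundary use only points of the list. -/
theorem bdL_sub {K : Type} (l : List K) :
    bdL l ∈ Finsupp.supported ℤ ℤ {l' : List K | ∀ p ∈ l', p ∈ l} := by
  induction l with
  | nil => simp [bdL]
  | cons a l ih =>
    rw [bdL]
    refine Submodule.sub_mem _ (Finsupp.single_mem_supported _ _ ?_) ?_
    · intro p hp; simp [hp]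
    · refine supp_induct _ _ _ (fun l' hl' => ?_) ih
      rw [cone_bs]
      refine Finsupp.single_mem_supported _ _ ?_
      intro p hp
      rcases List.mem_cons.1 hp with rfl | h
      · simp
      · simp [hl' p h]

/-- map on ordered chains -/
noncomputable def mp {K K' : Type} (f : K → K') : A K →ₗ[ℤ] A K' := lin (fun l => bs (l.map f))

@[simp] theorem mp_bs {K K' : Type} (f : K → K') (l : List K) : mp f (bs l) = bs (l.map f) := by
  simp [mp]

theorem mp_cone {K K' : Type} (f : K → K') (b : K) (c : A K) :
    mp f (cone b c) = cone (f b) (mp f c) :=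
  lin_ext (L := mp f ∘ₗ cone b) (L' := cone (f b) ∘ₗ mp f) (fun l => by simp) c

theorem mp_bdL {K K' : Type} (f : K → K') (l : List K) : mp f (bdL l) = bdL (l.map f) := by
  induction l with
  | nil => simp [bdL]
  | cons b l ih => simp [bdL, mp_cone, ih]

theorem mp_bd {K K' : Type} (f : K → K') (c : A K) : mp f (bd c) = bd (mp f c) :=
  lin_ext (L := mp f ∘ₗ bd) (L' := bd ∘ₗ mp f) (fun l => by simp [mp_bdL]) c

section recursion
variable {K K' : Type} (β : K → List K → K') (ψ : A K →ₗ[ℤ] A K') (s : ℤ) (φ₀ : A K')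

/-- Recursion by cones. -/
noncomputable def recN : ℕ → (A K →ₗ[ℤ] A K')
  | 0 => lin (fun _ => φ₀)
  | n + 1 => lin (fun l => match l with
    | [] => φ₀
    | a :: t => cone (β a t) (ψ (bs (a :: t)) + s • recN n (bdL (a :: t))))

noncomputable def rc : A K →ₗ[ℤ] A K' := lin (fun l => recN β ψ s φ₀ l.length (bs l))

theorem rc_nil : rc β ψ s φ₀ (bs []) = φ₀ := by simp [rc, recN]

theorem rc_cons (a : K) (t : List K) : rc β ψ s φ₀ (bs (a :: t)) =
    cone (β a t) (ψ (bs (a :: t)) + s • rc β ψ s φ₀ (bdL (a :: t))) := by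
  have h : rc β ψ s φ₀ (bdL (a :: t)) = recN β ψ s φ₀ t.length (bdL (a :: t)) := by
    refine supp_eq _ _ _ (fun l hl => ?_) (bdL_len a t)
    have hl : l.length = t.length := hl
    simp [rc, hl]
  rw [h]
  simp [rc, recN]

end recursion

theorem rc_nat {K K' J J' : Type} (β : K → List K → K') (ψ : A K →ₗ[ℤ] A K') (s : ℤ) (φ₀ : A K')
    (β' : J → List J → J') (ψ' : A J →ₗ[ℤ] A J') (φ₀' : A J') (f : K → J) (g : K' → J')
    (hβ : ∀ a t, g (β a t) = β' (f a) (t.map f)) (hψ : ∀ c, mp g (ψ c) = ψ' (mp f c))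
    (hφ : mp g φ₀ = φ₀') (c : A K) :
    mp g (rc β ψ s φ₀ c) = rc β' ψ' s φ₀' (mp f c) := by
  have key : ∀ n : ℕ, ∀ l : List K, l.length = n →
      mp g (rc β ψ s φ₀ (bs l)) = rc β' ψ' s φ₀' (mp f (bs l)) := by
    intro n
    induction n with
    | zero =>
      intro l hl
      obtain rfl := List.length_eq_zero_iff.1 hl
      rw [mp_bs, List.map_nil, rc_nil, rc_nil, hφ]
    | succ n ih =>
      intro l hl
      match l, hl with
      | a :: t, hl =>
        have h2 : mp g (rc β ψ s φ₀ (bdL (a :: t))) = rc β' ψ' s φ₀' (mp f (bdL (a :: t))) := by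
          have hm := bdL_len a t
          have : t.length = n := by simpa using hl
          rw [this] at hm
          exact supp_eq (mp g ∘ₗ rc β ψ s φ₀) (rc β' ψ' s φ₀' ∘ₗ mp f) _ (fun l hl => ih l hl) hm
        rw [rc_cons, mp_bs, List.map_cons, rc_cons, mp_cone, map_add, map_smul, hψ, h2, hβ, mp_bdL,
          mp_bs]
        rfl
  exact lin_ext (L := mp g ∘ₗ rc β ψ s φ₀) (L' := rc β' ψ' s φ₀' ∘ₗ mp f)
    (fun l => key _ l rfl) c

/-- Chain homotopies built by cones. -/
theorem rc_htpy {K K' : Type} (β : K → List K → K') (ψ : A K →ₗ[ℤ] A K')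
    (hψ : ∀ c, bd (ψ c) = ψ (bd c)) (h0 : ψ (bs []) = 0) (c : A K) :
    bd (rc β ψ (-1) 0 c) + rc β ψ (-1) 0 (bd c) = ψ c := by
  have key : ∀ n : ℕ, ∀ l : List K, l.length = n →
      bd (rc β ψ (-1) 0 (bs l)) + rc β ψ (-1) 0 (bd (bs l)) = ψ (bs l) := by
    intro n
    induction n with
    | zero =>
      intro l hl
      obtain rfl := List.length_eq_zero_iff.1 hl
      rw [rc_nil, h0, bd_bs]
      simp [bdL]
    | succ n ih =>
      intro l hl
      match l, hl with
      | a :: t, hl =>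
        have hm := bdL_len a t
        have : t.length = n := by simpa using hl
        rw [this] at hm
        have h2 := supp_eq (bd ∘ₗ rc β ψ (-1) 0 + rc β ψ (-1) 0 ∘ₗ bd) ψ _ (fun l hl => ih l hl) hm
        simp only [LinearMap.add_apply, LinearMap.comp_apply] at h2
        rw [← bd_bs, bd_bd, map_zero, add_zero] at h2
        rw [rc_cons, bd_cone, map_add, hψ, map_smul, ← bd_bs, h2]
        simp
  exact lin_ext (L := bd ∘ₗ rc β ψ (-1) 0 + rc β ψ (-1) 0 ∘ₗ bd) (L' := ψ)
    (fun l => key _ l rfl) c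

/-- Chain maps built by cones. -/
theorem rc_chain {K K' : Type} (β : K → List K → K') (c : A K) :
    bd (rc β 0 1 (bs []) c) = rc β 0 1 (bs []) (bd c) := by
  have key : ∀ n : ℕ, ∀ l : List K, l.length = n →
      bd (rc β 0 1 (bs []) (bs l)) = rc β 0 1 (bs []) (bd (bs l)) := by
    intro n
    induction n with
    | zero =>
      intro l hl
      obtain rfl := List.length_eq_zero_iff.1 hl
      rw [rc_nil, bd_bs]
      simp [bdL]
    | succ n ih =>
      intro l hl
      match l, hl with
      | a :: t, hl =>
        have hm := bdL_len a t
        have : t.length = n := by simpa using hl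
        rw [this] at hm
        have h2 := supp_eq (bd ∘ₗ rc β 0 1 (bs [])) (rc β 0 1 (bs []) ∘ₗ bd) _
          (fun l hl => ih l hl) hm
        simp only [LinearMap.comp_apply] at h2
        rw [← bd_bs, bd_bd, map_zero] at h2
        rw [rc_cons, bd_cone, LinearMap.zero_apply, zero_add, one_smul, ← bd_bs, h2]
        simp
  exact lin_ext (L := bd ∘ₗ rc β 0 1 (bs [])) (L' := rc β 0 1 (bs []) ∘ₗ bd)
    (fun l => key _ l rfl) c

end TB

namespace TB

/-- The standard simplex with `m` vertices (empty for `m = 0`). -/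
abbrev Sx (m : ℕ) : Type := stdSimplex ℝ (Fin m)

noncomputable def vert {m : ℕ} (i : Fin m) : Sx m := ⟨Pi.single i 1, single_mem_stdSimplex ℝ i⟩

noncomputable def combS {n m : ℕ} (w : Fin m → Sx n) : C(Sx m, Sx n) where
  toFun t := ⟨∑ i, t.1 i • (w i).1,
    (convex_stdSimplex ℝ (Fin n)).sum_mem (fun i _ => t.2.1 i) t.2.2 (fun i _ => (w i).2)⟩
  continuous_toFun := by
    refine Continuous.subtype_mk ?_ _
    refine continuous_finsetSum _ (fun i _ => ?_)
    exact ((continuous_apply i).comp continuous_subtype_val).smul continuous_const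

theorem combS_val {n m : ℕ} (w : Fin m → Sx n) (t : Sx m) :
    (combS w t).1 = ∑ i, t.1 i • (w i).1 := rfl

theorem combS_vert {n m : ℕ} (w : Fin m → Sx n) (i : Fin m) : combS w (vert i) = w i := by
  apply Subtype.ext
  rw [combS_val, Finset.sum_eq_single i]
  · simp [vert]
  · intro j _ hj; simp [vert, hj]
  · simp

theorem combS_combS {l n m : ℕ} (w : Fin m → Sx n) (v : Fin l → Sx m) (t : Sx l) :
    combS w (combS v t) = combS (fun j => combS w (v j)) t := by
  apply Subtype.ext
  simp only [combS_val, Finset.sum_apply, Pi.smul_apply, Finset.sum_smul, Finset.smul_sum, smul_smul,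
    smul_eq_mul]
  rw [Finset.sum_comm]

theorem combS_id {m : ℕ} (t : Sx m) : combS (vert (m := m)) t = t := by
  apply Subtype.ext
  ext j
  simp [combS_val, vert, Pi.single_apply]

class Cvx (K : Type) [TopologicalSpace K] where
  comb : ∀ {m : ℕ}, (Fin m → K) → C(Sx m, K)
  comb_vert : ∀ {m : ℕ} (w : Fin m → K) (i : Fin m), comb w (vert i) = w i
  comb_comb : ∀ {l m : ℕ} (w : Fin m → K) (v : Fin l → Sx m) (t : Sx l),
    comb w (combS v t) = comb (fun j => comb w (v j)) t

open Cvx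

noncomputable instance (n : ℕ) : Cvx (Sx n) := ⟨combS, combS_vert, combS_combS⟩

noncomputable instance {K J : Type} [TopologicalSpace K] [TopologicalSpace J] [Cvx K] [Cvx J] :
    Cvx (K × J) where
  comb w := (comb (fun i => (w i).1)).prodMk (comb (fun i => (w i).2))
  comb_vert w i := by simp [comb_vert]
  comb_comb w v t := by simp [comb_comb]

/-- singular simplices, indexed by the number of vertices (including the empty simplex) -/
abbrev SS (E : Type) [TopologicalSpace E] := Σ m : ℕ, C(Sx m, E)

/-- augmented singular chains -/
abbrev Ch (E : Type) [TopologicalSpace E] := SS E →₀ ℤ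

section
variable {E K J : Type} [TopologicalSpace E] [TopologicalSpace K] [TopologicalSpace J] [Cvx K] [Cvx J]

noncomputable def simp1 (g : C(K, E)) (p : Σ n, Fin n → K) : SS E := ⟨p.1, g.comp (comb p.2)⟩

noncomputable def reL (g : C(K, E)) (l : List K) : SS E := simp1 g (List.equivSigmaTuple l)

noncomputable def re (g : C(K, E)) : A K →ₗ[ℤ] Ch E := lin (fun l => bs (reL g l))

@[simp] theorem re_bs (g : C(K, E)) (l : List K) : re g (bs l) = bs (reL g l) := by simp [re]

theorem reL_ofFn (g : C(K, E)) {m : ℕ} (w : Fin m → K) :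
    reL g (List.ofFn w) = ⟨m, g.comp (comb w)⟩ := by
  have : List.equivSigmaTuple (List.ofFn w) = ⟨m, w⟩ :=
    List.equivSigmaTuple.right_inv ⟨m, w⟩
  rw [reL, this, simp1]

theorem exists_ofFn {K : Type} (l : List K) : ∃ (m : ℕ) (w : Fin m → K), l = List.ofFn w :=
  ⟨l.length, l.get, (List.ofFn_get l).symm⟩

theorem re_mp (g : C(J, E)) (f : C(K, J))
    (hf : ∀ (m : ℕ) (v : Fin m → K) (t : Sx m), f (comb v t) = comb (fun i => f (v i)) t) (c : A K) :
    re g (mp f c) = re (g.comp f) c := by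
  refine lin_ext (L := re g ∘ₗ mp f) (L' := re (g.comp f)) (fun l => ?_) c
  obtain ⟨m, w, rfl⟩ := exists_ofFn l
  simp only [LinearMap.comp_apply, mp_bs, re_bs, List.map_ofFn, reL_ofFn]
  congr 2
  ext t
  simp only [ContinuousMap.comp_apply, hf]
  rfl

noncomputable def verts (m : ℕ) : List (Sx m) := List.ofFn vert

theorem re_verts {m : ℕ} (σ : C(Sx m, E)) : re σ (bs (verts m)) = bs ⟨m, σ⟩ := by
  rw [re_bs, verts, reL_ofFn]
  congr 2
  ext t
  exact congrArg σ (combS_id t)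

theorem mp_verts {m : ℕ} (w : Fin m → K) :
    mp (comb w : Sx m → K) (bs (verts m)) = bs (List.ofFn w) := by
  rw [mp_bs, verts, List.map_ofFn]
  congr 2
  funext i
  exact comb_vert w i

/-- operator on singular chains induced by operators on ordered chains of simplices -/
noncomputable def op (Φ : ∀ m, A (Sx m) →ₗ[ℤ] A (Sx m)) : Ch E →ₗ[ℤ] Ch E :=
  lin (fun σ => re σ.2 (Φ σ.1 (bs (verts σ.1))))

theorem op_re (Φ : ∀ m, A (Sx m) →ₗ[ℤ] A (Sx m)) (ΦK : A K →ₗ[ℤ] A K)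
    (hΦ : ∀ m (w : Fin m → K) c, mp (comb w : Sx m → K) (Φ m c) = ΦK (mp (comb w : Sx m → K) c))
    (g : C(K, E)) (c : A K) : op Φ (re g c) = re g (ΦK c) := by
  refine lin_ext (L := op Φ ∘ₗ re g) (L' := re g ∘ₗ ΦK) (fun l => ?_) c
  obtain ⟨m, w, rfl⟩ := exists_ofFn l
  simp only [LinearMap.comp_apply, re_bs, reL_ofFn]
  rw [op, lin_single]
  dsimp only
  rw [← re_mp g (comb w), hΦ, mp_verts]
  intro l v t
  exact comb_comb w v t

end

variable {E : Type} [TopologicalSpace E]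

noncomputable def dS : Ch E →ₗ[ℤ] Ch E := op (fun _ => bd)

theorem dS_re {K : Type} [TopologicalSpace K] [Cvx K] (g : C(K, E)) (c : A K) :
    dS (re g c) = re g (bd c) :=
  op_re _ bd (fun _ _ _ => mp_bd _ _) g c

theorem dS_bs (σ : SS E) : dS (bs σ) = re σ.2 (bdL (verts σ.1)) := by
  simp [dS, op]

theorem dS_dS (c : Ch E) : dS (dS c) = 0 := by
  refine lin_ext (L := dS ∘ₗ dS) (L' := 0) (fun σ => ?_) c
  simp only [LinearMap.comp_apply, LinearMap.zero_apply]
  rw [dS_bs, dS_re, ← bd_bs, bd_bd, map_zero]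

/-- barycenter -/
noncomputable def bary {m : ℕ} (a : Sx m) (t : List (Sx m)) : Sx m :=
  combS (a :: t).get ⟨fun _ => ((t.length : ℝ) + 1)⁻¹, fun _ => by positivity, by
    simp; field_simp⟩

theorem bary_val {m : ℕ} (a : Sx m) (t : List (Sx m)) :
    (bary a t).1 = ((t.length : ℝ) + 1)⁻¹ • ((a :: t).map (fun p => p.1)).sum := by
  rw [bary, combS_val, ← Finset.smul_sum]
  congr 1
  rw [← List.sum_ofFn]
  congr 1
  rw [← Function.comp_def (fun p : Sx m => p.1), ← List.map_ofFn, List.ofFn_get]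

theorem bary_nat {m n : ℕ} (w : Fin m → Sx n) (a : Sx m) (t : List (Sx m)) :
    combS w (bary a t) = bary (combS w a) (t.map (combS w)) := by
  apply Subtype.ext
  let L : (Fin m → ℝ) →ₗ[ℝ] (Fin n → ℝ) :=
    ∑ i, (LinearMap.proj i : (Fin m → ℝ) →ₗ[ℝ] ℝ).smulRight (w i).1
  have hL : ∀ t : Sx m, (combS w t).1 = L t.1 := by
    intro t; simp [L, combS_val]
  rw [hL, bary_val, bary_val, map_smul, List.length_map]
  congr 1
  rw [map_list_sum, List.map_map, ← List.map_cons, List.map_map]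
  congr 1
  apply List.map_congr_left
  intro p _
  simp [hL]

/-- subdivision on ordered chains -/
noncomputable def sd (m : ℕ) : A (Sx m) →ₗ[ℤ] A (Sx m) := rc bary 0 1 (bs [])

theorem sd_nat {m n : ℕ} (w : Fin m → Sx n) (c : A (Sx m)) :
    mp (combS w) (sd m c) = sd n (mp (combS w) c) :=
  rc_nat _ _ _ _ _ _ _ _ _ (bary_nat w) (by simp) (by simp) c

noncomputable def tt (m : ℕ) : A (Sx m) →ₗ[ℤ] A (Sx m) :=
  rc (fun a _ => a) (LinearMap.id - sd m) (-1) 0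

theorem tt_nat {m n : ℕ} (w : Fin m → Sx n) (c : A (Sx m)) :
    mp (combS w) (tt m c) = tt n (mp (combS w) c) :=
  rc_nat _ _ _ _ _ _ _ _ _ (by simp) (by simp [sd_nat]) (by simp) c

theorem tt_htpy {m : ℕ} (c : A (Sx m)) : bd (tt m c) + tt m (bd c) = c - sd m c := by
  have := rc_htpy (fun (a : Sx m) _ => a) (LinearMap.id - sd m)
    (fun c => by simp [sd, rc_chain]) (by simp [sd, rc_nil]) c
  simpa [tt] using this

noncomputable def SdS : Ch E →ₗ[ℤ] Ch E := op sd
noncomputable def TS : Ch E →ₗ[ℤ] Ch E := op tt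

theorem SdS_re {m : ℕ} (g : C(Sx m, E)) (c : A (Sx m)) : SdS (re g c) = re g (sd m c) :=
  op_re _ (sd m) (fun _ _ _ => sd_nat _ _) g c

theorem TS_re {m : ℕ} (g : C(Sx m, E)) (c : A (Sx m)) : TS (re g c) = re g (tt m c) :=
  op_re _ (tt m) (fun _ _ _ => tt_nat _ _) g c

theorem TS_htpy (c : Ch E) : dS (TS c) + TS (dS c) = c - SdS c := by
  refine lin_ext (L := dS ∘ₗ TS + TS ∘ₗ dS) (L' := LinearMap.id - SdS) (fun σ => ?_) c
  simp only [LinearMap.comp_apply, LinearMap.add_apply, LinearMap.sub_apply, LinearMap.id_apply]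
  obtain ⟨m, σ⟩ := σ
  rw [← bs, ← re_verts, dS_re, TS_re, TS_re, SdS_re, dS_re, ← map_add, tt_htpy, map_sub]

/-- prism operator on ordered chains -/
noncomputable def pr (m : ℕ) : A (Sx m) →ₗ[ℤ] A (Sx m × Sx 2) :=
  rc (fun a _ => (a, vert 0)) (mp (fun a => (a, vert 1)) - mp (fun a => (a, vert 0))) (-1) 0

theorem mp_mp {K K' K'' : Type} (f : K → K') (g : K' → K'') (c : A K) :
    mp g (mp f c) = mp (g ∘ f) c :=
  lin_ext (L := mp g ∘ₗ mp f) (L' := mp (g ∘ f)) (fun l => by simp) c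

theorem pr_nat {m n : ℕ} (w : Fin m → Sx n) (c : A (Sx m)) :
    mp (Prod.map (combS w) id) (pr m c) = pr n (mp (combS w) c) :=
  rc_nat _ _ _ _ _ _ _ _ _ (by simp) (by
    intro c
    simp only [LinearMap.sub_apply, map_sub, mp_mp]
    rfl) (by simp) c

theorem pr_htpy {m : ℕ} (c : A (Sx m)) : bd (pr m c) + pr m (bd c) =
    mp (fun a => (a, vert 1)) c - mp (fun a => (a, vert 0)) c := by
  have := rc_htpy (fun (a : Sx m) _ => (a, (vert 0 : Sx 2)))
    (mp (fun a => (a, vert 1)) - mp (fun a => (a, vert 0)))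
    (fun c => by simp [mp_bd]) (by simp) c
  simpa [pr] using this

/-- push forward of singular chains -/
noncomputable def push {E' : Type} [TopologicalSpace E'] (f : C(E, E')) : Ch E →ₗ[ℤ] Ch E' :=
  lin (fun σ => bs ⟨σ.1, f.comp σ.2⟩)

theorem push_re {E' : Type} [TopologicalSpace E'] {K : Type} [TopologicalSpace K] [Cvx K]
    (f : C(E, E')) (g : C(K, E)) (c : A K) : push f (re g c) = re (f.comp g) c := by
  refine lin_ext (L := push f ∘ₗ re g) (L' := re (f.comp g)) (fun l => ?_) c
  simp only [LinearMap.comp_apply, re_bs]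
  rw [push, lin_single]
  rfl

theorem push_dS {E' : Type} [TopologicalSpace E'] (f : C(E, E')) (c : Ch E) :
    push f (dS c) = dS (push f c) := by
  refine lin_ext (L := push f ∘ₗ dS) (L' := dS ∘ₗ push f) (fun σ => ?_) c
  simp only [LinearMap.comp_apply]
  rw [dS_bs, push_re, push, lin_single, dS_bs]

/-- the map of a prism over a simplex -/
noncomputable def prG (h : C(E × Sx 2, E)) {m : ℕ} (σ : C(Sx m, E)) : C(Sx m × Sx 2, E) :=
  h.comp (σ.prodMap (ContinuousMap.id _))

noncomputable def DS (h : C(E × Sx 2, E)) : Ch E →ₗ[ℤ] Ch E :=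
  lin (fun σ => re (prG h σ.2) (pr σ.1 (bs (verts σ.1))))

theorem DS_re (h : C(E × Sx 2, E)) {n : ℕ} (g : C(Sx n, E)) (c : A (Sx n)) :
    DS h (re g c) = re (prG h g) (pr n c) := by
  refine lin_ext (L := DS h ∘ₗ re g) (L' := re (prG h g) ∘ₗ pr n) (fun l => ?_) c
  obtain ⟨m, w, rfl⟩ := exists_ofFn l
  simp only [LinearMap.comp_apply, re_bs, reL_ofFn]
  rw [DS, lin_single]
  dsimp only
  have h1 : pr n (bs (List.ofFn w)) =
      mp ((combS w).prodMap (ContinuousMap.id (Sx 2))) (pr m (bs (verts m))) := by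
    have h2 : mp (combS w : Sx m → Sx n) (bs (verts m)) = bs (List.ofFn w) := mp_verts w
    rw [← h2, ← pr_nat]
    rfl
  rw [h1]
  have := re_mp (prG h g) ((combS w).prodMap (ContinuousMap.id (Sx 2))) (by
    intro l v t
    refine Prod.ext ?_ rfl
    exact comb_comb w _ t) (pr m (bs (verts m)))
  rw [this]
  rfl

/-- the end maps of a homotopy -/
noncomputable def hEnd (h : C(E × Sx 2, E)) (i : Fin 2) : C(E, E) :=
  h.comp ((ContinuousMap.id E).prodMk (ContinuousMap.const E (vert i)))

theorem DS_htpy (h : C(E × Sx 2, E)) (c : Ch E) :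
    dS (DS h c) + DS h (dS c) = push (hEnd h 1) c - push (hEnd h 0) c := by
  refine lin_ext (L := dS ∘ₗ DS h + DS h ∘ₗ dS) (L' := push (hEnd h 1) - push (hEnd h 0))
    (fun σ => ?_) c
  simp only [LinearMap.comp_apply, LinearMap.add_apply, LinearMap.sub_apply]
  obtain ⟨m, σ⟩ := σ
  have key : ∀ i : Fin 2, re (prG h σ) (mp (fun a => (a, (vert i : Sx 2))) (bs (verts m))) =
      push (hEnd h i) (bs ⟨m, σ⟩) := by
    intro i
    rw [← re_verts, push_re]
    have := re_mp (prG h σ) ((ContinuousMap.id (Sx m)).prodMk (ContinuousMap.const _ (vert i : Sx 2))) (by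
      intro l v t
      refine Prod.ext rfl ?_
      apply Subtype.ext
      change _ = ∑ j, t.1 j • (vert i : Sx 2).1
      rw [← Finset.sum_smul, t.2.2, one_smul]
      rfl) (bs (verts m))
    exact this
  rw [← key, ← key, ← map_sub, ← pr_htpy, ← bs, ← re_verts, DS_re, dS_re, dS_re, DS_re, map_add]

end TB

namespace TB
open Cvx
variable {E : Type} [TopologicalSpace E]

/-- chains supported in a subset -/
noncomputable def sub (X : Set E) : Submodule ℤ (Ch E) :=
  Finsupp.supported ℤ ℤ {σ | Set.range σ.2 ⊆ X}

/-- chains of simplices with `m` vertices -/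
noncomputable def hom (E : Type) [TopologicalSpace E] (m : ℕ) : Submodule ℤ (Ch E) :=
  Finsupp.supported ℤ ℤ {σ | σ.1 = m}

theorem bs_sub {X : Set E} {σ : SS E} (h : Set.range σ.2 ⊆ X) : bs σ ∈ sub X :=
  Finsupp.single_mem_supported _ _ h

theorem sub_mono {X Y : Set E} (h : X ⊆ Y) : sub X ≤ sub Y :=
  Finsupp.supported_mono (fun _ hσ => hσ.trans h)

theorem sub_inter {X Y : Set E} {c : Ch E} (h1 : c ∈ sub X) (h2 : c ∈ sub Y) : c ∈ sub (X ∩ Y) := by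
  have : c ∈ sub X ⊓ sub Y := ⟨h1, h2⟩
  rw [sub, sub, ← Finsupp.supported_inter] at this
  exact Finsupp.supported_mono (fun _ hσ => Set.subset_inter hσ.1 hσ.2) this

theorem reL_range {K : Type} [TopologicalSpace K] [Cvx K] {X : Set E} (g : C(K, E))
    (hg : Set.range g ⊆ X) (l : List K) : Set.range (reL g l).2 ⊆ X := by
  rintro _ ⟨t, rfl⟩
  exact hg ⟨_, rfl⟩

theorem re_sub {K : Type} [TopologicalSpace K] [Cvx K] {X : Set E} (g : C(K, E))
    (hg : Set.range g ⊆ X) (c : A K) : re g c ∈ sub X := by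
  refine supp_induct (re g) Set.univ _ (fun l _ => ?_) (by simp)
  rw [re_bs]
  exact bs_sub (reL_range g hg l)

theorem op_sub (Φ : ∀ m, A (Sx m) →ₗ[ℤ] A (Sx m)) {X : Set E} {c : Ch E} (hc : c ∈ sub X) :
    op Φ c ∈ sub X := by
  refine supp_induct _ _ _ (fun σ hσ => ?_) hc
  rw [op, lin_single]
  exact re_sub _ hσ _

theorem dS_sub {X : Set E} {c : Ch E} (hc : c ∈ sub X) : dS c ∈ sub X := op_sub _ hc
theorem SdS_sub {X : Set E} {c : Ch E} (hc : c ∈ sub X) : SdS c ∈ sub X := op_sub _ hc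
theorem TS_sub {X : Set E} {c : Ch E} (hc : c ∈ sub X) : TS c ∈ sub X := op_sub _ hc

theorem DS_sub (h : C(E × Sx 2, E)) {X Y : Set E} (hX : ∀ x ∈ X, ∀ t, h (x, t) ∈ Y) {c : Ch E}
    (hc : c ∈ sub X) : DS h c ∈ sub Y := by
  refine supp_induct _ _ _ (fun σ hσ => ?_) hc
  rw [DS, lin_single]
  refine re_sub _ ?_ _
  rintro _ ⟨⟨a, t⟩, rfl⟩
  exact hX _ (hσ ⟨a, rfl⟩) t

theorem push_sub {E' : Type} [TopologicalSpace E'] (f : C(E, E')) {X : Set E} {Y : Set E'}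
    (hX : ∀ x ∈ X, f x ∈ Y) {c : Ch E} (hc : c ∈ sub X) : push f c ∈ sub Y := by
  refine supp_induct _ _ _ (fun σ hσ => ?_) hc
  rw [push, lin_single]
  refine bs_sub ?_
  rintro _ ⟨a, rfl⟩
  exact hX _ (hσ ⟨a, rfl⟩)

theorem push_hom {E' : Type} [TopologicalSpace E'] (f : C(E, E')) {m : ℕ} {c : Ch E}
    (hc : c ∈ hom E m) : push f c ∈ hom E' m := by
  refine supp_induct _ _ _ (fun σ hσ => ?_) hc
  rw [push, lin_single]
  exact Finsupp.single_mem_supported _ _ hσ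

theorem reL_fst {K : Type} [TopologicalSpace K] [Cvx K] (g : C(K, E)) (l : List K) :
    (reL g l).1 = l.length := rfl

theorem re_hom {K : Type} [TopologicalSpace K] [Cvx K] (g : C(K, E)) {n : ℕ} {c : A K}
    (hc : c ∈ len K n) : re g c ∈ hom E n := by
  refine supp_induct _ _ _ (fun l hl => ?_) hc
  rw [re_bs]
  exact Finsupp.single_mem_supported _ _ hl

/-- projection to a degree -/
noncomputable def pj (m : ℕ) : Ch E →ₗ[ℤ] Ch E := lin (fun σ => if σ.1 = m then bs σ else 0)

theorem pj_of_mem {m : ℕ} {c : Ch E} (hc : c ∈ hom E m) : pj m c = c := by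
  refine supp_eq (pj m) LinearMap.id _ (fun σ hσ => ?_) hc
  have : σ.1 = m := hσ
  simp [pj, this]

theorem pj_of_ne {m n : ℕ} {c : Ch E} (hc : c ∈ hom E m) (h : m ≠ n) : pj n c = 0 := by
  refine supp_eq (pj n) 0 _ (fun σ hσ => ?_) hc
  have : σ.1 = m := hσ
  simp [pj, this, h]

theorem pj_hom (m : ℕ) (c : Ch E) : pj m c ∈ hom E m := by
  refine supp_induct (pj m) Set.univ _ (fun σ _ => ?_) (by simp)
  rw [pj, lin_single]
  split_ifs with h
  · exact Finsupp.single_mem_supported _ _ h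
  · exact Submodule.zero_mem _

theorem pj_sub (m : ℕ) {X : Set E} {c : Ch E} (hc : c ∈ sub X) : pj m c ∈ sub X := by
  refine supp_induct _ _ _ (fun σ hσ => ?_) hc
  rw [pj, lin_single]
  split_ifs with h
  · exact bs_sub hσ
  · exact Submodule.zero_mem _

theorem dS_bs_hom {m : ℕ} (σ : C(Sx (m + 1), E)) : dS (bs ⟨m + 1, σ⟩) ∈ hom E m := by
  rw [dS_bs]
  refine re_hom _ ?_
  dsimp only
  have h := bdL_len (vert (0 : Fin (m + 1))) (List.ofFn (fun i : Fin m => vert i.succ))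
  rw [List.length_ofFn] at h
  rw [verts, List.ofFn_succ]
  exact h

theorem dS_bs_zero (σ : C(Sx 0, E)) : dS (bs ⟨0, σ⟩) = 0 := by
  rw [dS_bs]
  have : verts 0 = [] := by rw [verts, List.ofFn_zero]
  dsimp only
  rw [this, bdL, map_zero]

theorem pj_dS_bs (m : ℕ) (σ : SS E) : pj m (dS (bs σ)) = dS (pj (m + 1) (bs σ)) := by
  obtain ⟨n, σ⟩ := σ
  rcases n with _ | n
  · have h : (bs (⟨0, σ⟩ : SS E)) ∈ hom E 0 := Finsupp.single_mem_supported _ _ rfl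
    rw [pj_of_ne h (Nat.succ_ne_zero m).symm, dS_bs_zero, map_zero, map_zero]
  · have h' : (bs (⟨n + 1, σ⟩ : SS E)) ∈ hom E (n + 1) := Finsupp.single_mem_supported _ _ rfl
    by_cases h : n = m
    · subst h
      rw [pj_of_mem (dS_bs_hom σ), pj_of_mem h']
    · rw [pj_of_ne (dS_bs_hom σ) h, pj_of_ne h' (by omega), map_zero]

theorem pj_dS (m : ℕ) (c : Ch E) : pj m (dS c) = dS (pj (m + 1) c) := by
  induction c using Finsupp.induction_linear with
  | zero => simp only [map_zero]
  | add f g hf hg => simp only [map_add, hf, hg]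
  | single σ a =>
    have : Finsupp.single σ a = a • bs σ := by simp [bs]
    rw [this, map_smul, map_smul, map_smul, map_smul, pj_dS_bs]

theorem dS_hom {m : ℕ} {c : Ch E} (hc : c ∈ hom E (m + 1)) : dS c ∈ hom E m := by
  rw [← pj_of_mem hc, ← pj_dS]
  exact pj_hom _ _

/-- the pairwise distance bound -/
def Close {m : ℕ} (d : ℝ) (l : List (Sx m)) : Prop := ∀ p ∈ l, ∀ q ∈ l, dist p q ≤ d

theorem bary_convex {m : ℕ} (a : Sx m) (t : List (Sx m)) (C : Set (Fin m → ℝ)) (hC : Convex ℝ C)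
    (h : ∀ q ∈ a :: t, q.1 ∈ C) : (bary a t).1 ∈ C := by
  rw [bary, combS_val]
  refine hC.sum_mem (fun i _ => by simp; positivity) ?_ (fun i _ => h _ (List.get_mem _ _))
  simp; field_simp

theorem bary_dist {m : ℕ} (a : Sx m) (t : List (Sx m)) (d : ℝ) (hl : Close d (a :: t))
    (n : ℕ) (hn : t.length ≤ n) (hd : 0 ≤ d) (q : Sx m) (hq : q ∈ a :: t) :
    dist q.1 (bary a t).1 ≤ (n / (n + 1) : ℝ) * d := by
  obtain ⟨j, rfl⟩ := List.get_of_mem hq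
  have h0 : ((a :: t).get j).1 = ∑ i : Fin (a :: t).length, ((t.length : ℝ) + 1)⁻¹ • ((a :: t).get j).1 := by
    rw [← Finset.sum_smul]
    have : ∑ i : Fin (a :: t).length, ((t.length : ℝ) + 1)⁻¹ = 1 := by simp; field_simp
    rw [this, one_smul]
  rw [bary, combS_val]
  conv_lhs => rw [h0]
  rw [dist_eq_norm, ← Finset.sum_sub_distrib]
  have hb : ∀ i ∈ Finset.univ, ‖((t.length : ℝ) + 1)⁻¹ • ((a :: t).get j).1 -
      ((t.length : ℝ) + 1)⁻¹ • ((a :: t).get i).1‖ ≤ if i = j then 0 else ((t.length : ℝ) + 1)⁻¹ * d := by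
    intro i _
    split_ifs with h
    · subst h; simp
    · rw [← smul_sub, norm_smul, ← dist_eq_norm, Real.norm_of_nonneg (by positivity)]
      gcongr
      exact hl _ (List.get_mem _ _) _ (List.get_mem _ _)
  refine (norm_sum_le_of_le _ hb).trans ?_
  have h1 : ∀ i : Fin (a :: t).length, (if i = j then 0 else ((t.length : ℝ) + 1)⁻¹ * d) =
      ((t.length : ℝ) + 1)⁻¹ * d - if i = j then ((t.length : ℝ) + 1)⁻¹ * d else 0 := by
    intro i; split_ifs <;> simp
  simp_rw [h1]
  rw [Finset.sum_sub_distrib, Finset.sum_ite_eq' Finset.univ j]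
  simp only [Finset.sum_const, Finset.card_univ, Fintype.card_fin, List.length_cons, nsmul_eq_mul,
    Finset.mem_univ, if_true]
  push_cast
  have h2 : ((t.length : ℝ) + 1) * (((t.length : ℝ) + 1)⁻¹ * d) - ((t.length : ℝ) + 1)⁻¹ * d =
      (t.length / (t.length + 1) : ℝ) * d := by field_simp; ring
  rw [h2]
  refine mul_le_mul_of_nonneg_right ?_ hd
  have : (t.length : ℝ) ≤ n := by exact_mod_cast hn
  rw [div_le_div_iff₀ (by positivity) (by positivity)]
  nlinarith

theorem sd_mesh {m : ℕ} : ∀ (k : ℕ) (l : List (Sx m)), l.length = k →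
    sd m (bs l) ∈ Finsupp.supported ℤ ℤ {w : List (Sx m) | w.length = l.length ∧
      (∀ C : Set (Fin m → ℝ), Convex ℝ C → (∀ q ∈ l, q.1 ∈ C) → ∀ p ∈ w, p.1 ∈ C) ∧
      (∀ d : ℝ, 0 ≤ d → Close d l → ∀ n : ℕ, l.length ≤ n + 1 → Close ((n / (n + 1) : ℝ) * d) w)} := by
  intro k
  induction k with
  | zero =>
    intro l hl
    obtain rfl := List.length_eq_zero_iff.1 hl
    rw [sd, rc_nil]
    refine Finsupp.single_mem_supported _ _ ⟨rfl, ?_, ?_⟩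
    · simp
    · intros; simp [Close]
  | succ k ih =>
    intro l hl
    match l, hl with
    | a :: t, hl =>
      have ht : t.length = k := by simpa using hl
      rw [sd, rc_cons]
      simp only [LinearMap.zero_apply, zero_add, one_smul]
      have hm : bdL (a :: t) ∈ Finsupp.supported ℤ ℤ
          {l' : List (Sx m) | l'.length = k ∧ ∀ p ∈ l', p ∈ a :: t} := by
        have h1 : bdL (a :: t) ∈ Finsupp.supported ℤ ℤ {l' : List (Sx m) | l'.length = k} :=
          ht ▸ bdL_len a t
        have h2 : bdL (a :: t) ∈ Finsupp.supported ℤ ℤ {l' : List (Sx m) | ∀ p ∈ l', p ∈ a :: t} :=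
          bdL_sub (a :: t)
        rw [Finsupp.mem_supported] at *
        exact fun x hx => ⟨h1 hx, h2 hx⟩
      refine supp_induct (cone (bary a t) ∘ₗ rc bary 0 1 (bs [])) _ _ ?_ hm
      rintro l' ⟨hl', hsub⟩
      rw [LinearMap.comp_apply]
      refine supp_induct (cone (bary a t)) _ _ ?_ (ih l' hl')
      rintro w ⟨hw1, hw2, hw3⟩
      rw [← bs, cone_bs]
      refine Finsupp.single_mem_supported _ _ ⟨by simp [hw1, hl', ht], ?_, ?_⟩
      · intro C hC hlC p hp
        rcases List.mem_cons.1 hp with rfl | hp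
        · exact bary_convex a t C hC hlC
        · exact hw2 C hC (fun q hq => hlC q (hsub q hq)) p hp
      · intro d hd hcl n hn
        have htn : t.length ≤ n := by simpa using hn
        have hb : ∀ p ∈ w, dist p (bary a t) ≤ (n / (n + 1) : ℝ) * d := by
          intro p hp
          exact hw2 (Metric.closedBall (bary a t).1 ((n / (n + 1) : ℝ) * d)) (convex_closedBall _ _)
            (fun q hq => bary_dist a t d hcl n htn hd q (hsub q hq)) p hp
        have hw : Close ((n / (n + 1) : ℝ) * d) w :=
          hw3 d hd (fun p hp q hq => hcl p (hsub p hp) q (hsub q hq)) n (by omega)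
        intro p hp q hq
        rcases List.mem_cons.1 hp with rfl | hp <;> rcases List.mem_cons.1 hq with rfl | hq
        · rw [dist_self]; positivity
        · rw [dist_comm]; exact hb q hq
        · exact hb p hp
        · exact hw p hp q hq

theorem sd_iter {m : ℕ} (N : ℕ) (n : ℕ) (hn : m ≤ n + 1) :
    ((sd m)^[N]) (bs (verts m)) ∈ Finsupp.supported ℤ ℤ {w : List (Sx m) | w.length = m ∧
      Close ((n / (n + 1) : ℝ) ^ N * 2) w} := by
  induction N with
  | zero =>
    refine Finsupp.single_mem_supported _ _ ⟨by simp [verts], ?_⟩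
    intro p _ q _
    have hp := stdSimplex_subset_closedBall p.2
    have hq := stdSimplex_subset_closedBall q.2
    rw [mem_closedBall_zero_iff] at hp hq
    have : dist p q = dist p.1 q.1 := rfl
    rw [this, dist_eq_norm]
    have := norm_sub_le p.1 q.1
    simp only [pow_zero, one_mul]
    linarith
  | succ N ih =>
    rw [Function.iterate_succ_apply']
    refine supp_induct (sd m) _ _ ?_ ih
    rintro w ⟨hw1, hw2⟩
    refine Finsupp.supported_mono ?_ (sd_mesh _ w rfl)
    rintro v ⟨hv1, _, hv3⟩
    refine ⟨hv1.trans hw1, ?_⟩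
    have := hv3 _ (by positivity) hw2 n (by omega)
    rw [pow_succ', mul_assoc]
    exact this

theorem SdS_iter_re {m : ℕ} (N : ℕ) (g : C(Sx m, E)) (c : A (Sx m)) :
    (SdS^[N]) (re g c) = re g ((sd m)^[N] c) := by
  induction N with
  | zero => rfl
  | succ N ih => rw [Function.iterate_succ_apply', ih, SdS_re, Function.iterate_succ_apply']

theorem small_simplex {U V : Set E} (hU : IsOpen U) (hV : IsOpen V) (σ : SS E)
    (hσ : Set.range σ.2 ⊆ U ∪ V) : ∃ N, (SdS^[N]) (bs σ) ∈ sub U ⊔ sub V := by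
  obtain ⟨m, σ⟩ := σ
  have hcov : (Set.univ : Set (Sx m)) ⊆ ⋃ b : Bool, σ ⁻¹' (if b then U else V) := by
    intro x _
    rcases hσ ⟨x, rfl⟩ with h | h
    · exact Set.mem_iUnion.2 ⟨true, by simpa using h⟩
    · exact Set.mem_iUnion.2 ⟨false, by simpa using h⟩
  obtain ⟨δ, hδ, hL⟩ := lebesgue_number_lemma_of_metric isCompact_univ
    (fun b : Bool => (by cases b <;> simp [hU, hV] : IsOpen (if b then U else V)).preimage σ.continuous) hcov
  have hlim : Filter.Tendsto (fun N : ℕ => ((m : ℝ) / (m + 1)) ^ N * 2) Filter.atTop (nhds 0) := by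
    have : Filter.Tendsto (fun N : ℕ => ((m : ℝ) / (m + 1)) ^ N) Filter.atTop (nhds 0) :=
      tendsto_pow_atTop_nhds_zero_of_lt_one (by positivity)
        (by rw [div_lt_one (by positivity)]; linarith)
    simpa using this.mul_const 2
  obtain ⟨N, hN⟩ := (hlim.eventually (gt_mem_nhds hδ)).exists
  refine ⟨N, ?_⟩
  rw [← re_verts, SdS_iter_re]
  refine supp_induct (re σ) _ _ ?_ (sd_iter N m (by omega))
  rintro w ⟨-, hw⟩
  rw [← bs, re_bs]
  have hr : ∃ b : Bool, Set.range (reL σ w).2 ⊆ if b then U else V := by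
    rcases w with _ | ⟨p, w⟩
    · refine ⟨true, ?_⟩
      rintro _ ⟨t, rfl⟩
      exfalso
      have t' : Sx 0 := t
      have := t'.2.2
      simp at this
    · obtain ⟨b, hb⟩ := hL p (Set.mem_univ _)
      refine ⟨b, ?_⟩
      have key : ∀ t : Sx (p :: w).length, (combS (p :: w).get t).1 ∈ Metric.closedBall p.1 ((m / (m + 1) : ℝ) ^ N * 2) := by
        intro t
        rw [combS_val]
        refine (convex_closedBall _ _).sum_mem (fun i _ => t.2.1 i) t.2.2 (fun i _ => ?_)
        exact hw _ (List.get_mem _ _) p (by simp)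
      rintro _ ⟨t, rfl⟩
      apply hb
      exact lt_of_le_of_lt (key t) hN
  obtain ⟨b, hb⟩ := hr
  cases b
  · exact Submodule.mem_sup_right (bs_sub (by simpa using hb))
  · exact Submodule.mem_sup_left (bs_sub (by simpa using hb))

theorem SdS_sup {U V : Set E} {c : Ch E} (hc : c ∈ sub U ⊔ sub V) : SdS c ∈ sub U ⊔ sub V := by
  obtain ⟨u, hu, v, hv, rfl⟩ := Submodule.mem_sup.1 hc
  rw [map_add]
  exact Submodule.add_mem_sup (SdS_sub hu) (SdS_sub hv)

theorem TS_sup {U V : Set E} {c : Ch E} (hc : c ∈ sub U ⊔ sub V) : TS c ∈ sub U ⊔ sub V := by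
  obtain ⟨u, hu, v, hv, rfl⟩ := Submodule.mem_sup.1 hc
  rw [map_add]
  exact Submodule.add_mem_sup (TS_sub hu) (TS_sub hv)

theorem SdS_iter_sup {U V : Set E} {c : Ch E} (hc : c ∈ sub U ⊔ sub V) (N : ℕ) :
    (SdS^[N]) c ∈ sub U ⊔ sub V := by
  induction N with
  | zero => exact hc
  | succ N ih => rw [Function.iterate_succ_apply']; exact SdS_sup ih

theorem small_iter {U V : Set E} (hU : IsOpen U) (hV : IsOpen V) {z : Ch E}
    (hz : z ∈ sub (U ∪ V)) : ∃ N, (SdS^[N]) z ∈ sub U ⊔ sub V := by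
  rw [sub, Finsupp.supported_eq_span_single] at hz
  refine Submodule.span_induction (p := fun z _ => ∃ N, (SdS^[N]) z ∈ sub U ⊔ sub V)
    ?_ ?_ ?_ ?_ hz
  · rintro _ ⟨σ, hσ, rfl⟩
    exact small_simplex hU hV σ hσ
  · exact ⟨0, Submodule.zero_mem _⟩
  · rintro x y _ _ ⟨N, hN⟩ ⟨M, hM⟩
    refine ⟨N + M, ?_⟩
    rw [iterate_map_add]
    refine Submodule.add_mem _ ?_ ?_
    · rw [add_comm, Function.iterate_add_apply]; exact SdS_iter_sup hN M
    · rw [Function.iterate_add_apply]; exact SdS_iter_sup hM N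
  · rintro a x _ ⟨N, hN⟩
    refine ⟨N, ?_⟩
    have : (SdS^[N]) (a • x) = a • (SdS^[N]) x := by
      rw [← Module.End.pow_apply, map_smul, Module.End.pow_apply]
    rw [this]
    exact Submodule.smul_mem _ _ hN

theorem dS_SdS (c : Ch E) : dS (SdS c) = SdS (dS c) := by
  have h1 := congrArg dS (TS_htpy c)
  have h2 := TS_htpy (dS c)
  rw [map_add, dS_dS, zero_add, map_sub] at h1
  rw [dS_dS, map_zero, add_zero] at h2
  rw [h2] at h1
  exact (sub_right_injective h1).symm

/-- Small chains theorem. -/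
theorem small {U V : Set E} (hU : IsOpen U) (hV : IsOpen V) {m : ℕ} {z : Ch E}
    (hz : z ∈ sub (U ∪ V)) (hd : dS z ∈ sub U ⊔ sub V) (hm : z ∈ hom E m) :
    ∃ u ∈ sub U, ∃ v ∈ sub V, ∃ e ∈ sub (U ∪ V), u ∈ hom E m ∧ v ∈ hom E m ∧ z = u + v + dS e := by
  have key : ∀ N : ℕ, ∃ w ∈ sub U ⊔ sub V, ∃ e ∈ sub (U ∪ V), z = (SdS^[N]) z + w + dS e ∧
      dS ((SdS^[N]) z) ∈ sub U ⊔ sub V ∧ (SdS^[N]) z ∈ sub (U ∪ V) := by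
    intro N
    induction N with
    | zero => exact ⟨0, Submodule.zero_mem _, 0, Submodule.zero_mem _, by simp, hd, hz⟩
    | succ N ih =>
      obtain ⟨w, hw, e, he, h1, h2, h3⟩ := ih
      rw [Function.iterate_succ_apply']
      set y := (SdS^[N]) z
      refine ⟨w + TS (dS y), Submodule.add_mem _ hw (TS_sup h2), e + TS y,
        Submodule.add_mem _ he (TS_sub h3), ?_, ?_, SdS_sub h3⟩
      · have := TS_htpy y
        have h4 : y = SdS y + (dS (TS y) + TS (dS y)) := by rw [this]; abel
        rw [map_add]
        calc z = y + w + dS e := h1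
          _ = (SdS y + (dS (TS y) + TS (dS y))) + w + dS e := by rw [← h4]
          _ = _ := by abel
      · rw [dS_SdS]; exact SdS_sup h2
  obtain ⟨N, hN⟩ := small_iter hU hV hz
  obtain ⟨w, hw, e, he, h1, -, -⟩ := key N
  obtain ⟨u, hu, v, hv, huv⟩ := Submodule.mem_sup.1 (Submodule.add_mem _ hN hw)
  refine ⟨pj m u, pj_sub m hu, pj m v, pj_sub m hv, pj (m + 1) e, pj_sub _ he, pj_hom _ _,
    pj_hom _ _, ?_⟩
  rw [← pj_dS, ← map_add, ← map_add, huv, ← h1, pj_of_mem hm]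

end TB

namespace TB
variable {E : Type} [TopologicalSpace E]

/-- relative boundaries -/
noncomputable def Bd (X A : Set E) : Submodule ℤ (Ch E) := (sub X).map dS ⊔ sub A

theorem mem_Bd {X A : Set E} {z : Ch E} : z ∈ Bd X A ↔ ∃ y ∈ sub X, ∃ a ∈ sub A, z = dS y + a := by
  rw [Bd, Submodule.mem_sup]
  constructor
  · rintro ⟨_, ⟨y, hy, rfl⟩, a, ha, h⟩
    exact ⟨y, hy, a, ha, h.symm⟩
  · rintro ⟨y, hy, a, ha, h⟩
    exact ⟨_, ⟨y, hy, rfl⟩, a, ha, h.symm⟩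

theorem mem_Bd_hom {X A : Set E} {z : Ch E} {i : ℕ} (hi : z ∈ hom E i) (h : z ∈ Bd X A) :
    ∃ y ∈ sub X, ∃ a ∈ sub A, y ∈ hom E (i + 1) ∧ a ∈ hom E i ∧ z = dS y + a := by
  obtain ⟨y, hy, a, ha, h⟩ := mem_Bd.1 h
  refine ⟨pj (i + 1) y, pj_sub _ hy, pj i a, pj_sub _ ha, pj_hom _ _, pj_hom _ _, ?_⟩
  rw [← pj_dS, ← map_add, ← h, pj_of_mem hi]

theorem Bd_mono {X A X' A' : Set E} (hX : X ⊆ X') (hA : A ⊆ A') : Bd X A ≤ Bd X' A' :=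
  sup_le_sup (Submodule.map_mono (sub_mono hX)) (sub_mono hA)

def Good (d s : ℕ) (X A : Set E) : Prop :=
  ∀ (i : ℕ) (z : Ch E), z ∈ hom E (i + 1) → z ∈ sub X → dS z ∈ sub A →
    (∀ m : ℤ, m ≠ 0 → m • z ∈ Bd X A → z ∈ Bd X A) ∧ ((¬ ∃ t, i = s + t * d) → z ∈ Bd X A)

def Tr (X A X' A' : Set E) (j : ℕ) : Prop :=
  ∀ (i : ℕ) (z : Ch E), z ∈ hom E (i + j) → z ∈ sub X → dS z ∈ sub A →
    ∃ z' ∈ hom E i, z' ∈ sub X' ∧ dS z' ∈ sub A' ∧ ∀ m : ℤ, m • z ∈ Bd X A ↔ m • z' ∈ Bd X' A'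

theorem hom_zero_sub {X : Set E} {z : Ch E} (hz : z ∈ hom E 0) : z ∈ sub X := by
  refine Finsupp.supported_mono ?_ hz
  rintro ⟨m, σ⟩ (rfl : m = 0)
  rintro _ ⟨t, rfl⟩
  have := t.2.2
  simp at this

theorem Tr.good0 {X A X' A' : Set E} {d s : ℕ} (h : Tr X A X' A' 0) (hg : Good d s X' A') :
    Good d s X A := by
  intro i z h1 h2 h3
  obtain ⟨z', h1', h2', h3', h4⟩ := h (i + 1) z h1 h2 h3
  obtain ⟨ha, hb⟩ := hg i z' h1' h2' h3'
  have h5 := h4 1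
  simp only [one_smul] at h5
  exact ⟨fun m hm hz => h5.2 (ha m hm ((h4 m).1 hz)), fun hi => h5.2 (hb hi)⟩

theorem Tr.good1 {X A X' A' : Set E} {d s : ℕ} (h : Tr X A X' A' 1) (hg : Good d s X' A') :
    Good d (s + 1) X A := by
  intro i z h1 h2 h3
  obtain ⟨z', h1', h2', h3', h4⟩ := h i z h1 h2 h3
  have h5 := h4 1
  simp only [one_smul] at h5
  rcases i with _ | i
  · have : z ∈ Bd X A := h5.2 (Submodule.mem_sup_right (hom_zero_sub h1'))
    exact ⟨fun _ _ _ => this, fun _ => this⟩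
  obtain ⟨ha, hb⟩ := hg i z' h1' h2' h3'
  refine ⟨fun m hm hz => h5.2 (ha m hm ((h4 m).1 hz)), fun hi => h5.2 (hb ?_)⟩
  rintro ⟨t, rfl⟩
  exact hi ⟨t, by ring⟩

theorem exc_core {U V : Set E} (hU : IsOpen U) (hV : IsOpen V) {i : ℕ} {w : Ch E}
    (hi : w ∈ hom E i) (hw : w ∈ sub U) (hb : w ∈ Bd (U ∪ V) V) : w ∈ Bd U (U ∩ V) := by
  obtain ⟨y, hy, a, ha, hyi, -, h⟩ := mem_Bd_hom hi hb
  have hd : dS y = w - a := by rw [h]; abel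
  obtain ⟨u, hu, v, hv, e, he, -, -, h2⟩ := small hU hV hy (by
    rw [hd]
    exact Submodule.sub_mem _ (Submodule.mem_sup_left hw) (Submodule.mem_sup_right ha)) hyi
  have h3 : dS y = dS u + dS v := by rw [h2, map_add, map_add, dS_dS, add_zero]
  refine mem_Bd.2 ⟨u, hu, w - dS u, sub_inter (Submodule.sub_mem _ hw (dS_sub hu)) ?_, by abel⟩
  have : w - dS u = dS v + a := by rw [h, h3]; abel
  rw [this]
  exact Submodule.add_mem _ (dS_sub hv) ha

theorem Tr_exc1 {U V : Set E} (hU : IsOpen U) (hV : IsOpen V) : Tr (U ∪ V) V U (U ∩ V) 0 := by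
  intro i z h1 h2 h3
  obtain ⟨u, hu, v, hv, e, he, hui, hvi, h⟩ := small hU hV h2 (Submodule.mem_sup_right h3) h1
  refine ⟨u, hui, hu, sub_inter (dS_sub hu) ?_, fun m => ⟨fun hz => ?_, fun hz => ?_⟩⟩
  · have : dS u = dS z - dS v := by rw [h, map_add, map_add, dS_dS]; abel
    rw [this]
    exact Submodule.sub_mem _ h3 (dS_sub hv)
  · refine exc_core hU hV (Submodule.smul_mem _ m hui) (Submodule.smul_mem _ m hu) ?_
    have : m • u = m • z - m • dS e - m • v := by rw [h]; simp only [smul_add]; abel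
    rw [this]
    refine Submodule.sub_mem _ (Submodule.sub_mem _ hz (Submodule.smul_mem _ _ ?_))
      (Submodule.smul_mem _ _ (Submodule.mem_sup_right hv))
    exact Submodule.mem_sup_left ⟨e, he, rfl⟩
  · rw [h, smul_add, smul_add]
    refine Submodule.add_mem _ (Submodule.add_mem _ ?_ (Submodule.smul_mem _ _ (Submodule.mem_sup_right hv)))
      (Submodule.smul_mem _ _ (Submodule.mem_sup_left ⟨e, he, rfl⟩))
    exact Bd_mono Set.subset_union_left Set.inter_subset_right hz

theorem Tr_exc2 {U V : Set E} (hU : IsOpen U) (hV : IsOpen V) : Tr U (U ∩ V) (U ∪ V) V 0 := by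
  intro i z h1 h2 h3
  refine ⟨z, h1, sub_mono Set.subset_union_left h2, sub_mono Set.inter_subset_right h3, fun m =>
    ⟨fun hz => Bd_mono Set.subset_union_left Set.inter_subset_right hz, fun hz => ?_⟩⟩
  exact exc_core hU hV (Submodule.smul_mem _ m h1) (Submodule.smul_mem _ m h2) hz

theorem add_core {U V : Set E} (hU : IsOpen U) (hV : IsOpen V) {i : ℕ} {z : Ch E}
    (hi : z ∈ hom E i) (h1 : z ∈ Bd (U ∪ V) U) (h2 : z ∈ Bd (U ∪ V) V) : z ∈ Bd (U ∪ V) (U ∩ V) := by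
  obtain ⟨y, hy, a, ha, hyi, -, h⟩ := mem_Bd_hom hi h1
  obtain ⟨y', hy', a', ha', hyi', -, h'⟩ := mem_Bd_hom hi h2
  have hd : dS (y - y') = a' - a := by
    rw [map_sub, sub_eq_sub_iff_add_eq_add, ← h, h', add_comm]
  obtain ⟨p, hp, q, hq, e, he, -, -, h3⟩ := small hU hV (Submodule.sub_mem _ hy hy') (by
    rw [hd]
    exact Submodule.sub_mem _ (Submodule.mem_sup_right ha') (Submodule.mem_sup_left ha))
    (Submodule.sub_mem _ hyi hyi')
  have h4 : dS p + dS q = a' - a := by rw [← hd, h3, map_add, map_add, dS_dS, add_zero]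
  refine mem_Bd.2 ⟨y - p, Submodule.sub_mem _ hy (sub_mono Set.subset_union_left hp), a + dS p,
    sub_inter (Submodule.add_mem _ ha (dS_sub hp)) ?_, ?_⟩
  · have : a + dS p = a' - dS q := by rw [eq_sub_iff_add_eq, add_assoc, h4]; abel
    rw [this]
    exact Submodule.sub_mem _ ha' (dS_sub hq)
  · rw [h, map_sub]; abel

theorem Good.add {d s : ℕ} {U V : Set E} (hU : IsOpen U) (hV : IsOpen V)
    (gU : Good d s (U ∪ V) U) (gV : Good d s (U ∪ V) V) : Good d s (U ∪ V) (U ∩ V) := by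
  intro i z h1 h2 h3
  obtain ⟨a, b⟩ := gU i z h1 h2 (sub_mono Set.inter_subset_left h3)
  obtain ⟨a', b'⟩ := gV i z h1 h2 (sub_mono Set.inter_subset_right h3)
  exact ⟨fun m hm hz => add_core hU hV h1
      (a m hm (Bd_mono subset_rfl Set.inter_subset_left hz))
      (a' m hm (Bd_mono subset_rfl Set.inter_subset_right hz)),
    fun hi => add_core hU hV h1 (b hi) (b' hi)⟩

theorem Good.self {d s : ℕ} (Y : Set E) : Good d s Y Y := fun _ _ _ h _ =>
  ⟨fun _ _ _ => Submodule.mem_sup_right h, fun _ => Submodule.mem_sup_right h⟩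

theorem Good.finset {d s : ℕ} {Y : Set E} (hY : IsOpen Y) {ι : Type} (F : Finset ι) (W : ι → Set E)
    (hW : ∀ a ∈ F, IsClosed (W a)) (hdis : ∀ a ∈ F, ∀ b ∈ F, a ≠ b → Y ∩ W a ∩ W b = ∅)
    (hg : ∀ a ∈ F, Good d s Y (Y \ W a)) : Good d s Y (Y \ ⋃ a ∈ F, W a) := by
  classical
  induction F using Finset.induction_on with
  | empty => simpa using Good.self Y
  | insert a F ha ih =>
    have ih' := ih (fun b hb => hW b (by simp [hb])) (fun b hb c hc => hdis b (by simp [hb]) c (by simp [hc]))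
      (fun b hb => hg b (by simp [hb]))
    have hU : IsOpen (Y \ W a) := hY.sdiff (hW a (by simp))
    have hV : IsOpen (Y \ ⋃ b ∈ F, W b) :=
      hY.sdiff (isClosed_biUnion_finset (fun b hb => hW b (by simp [hb])))
    have e1 : Y = (Y \ W a) ∪ (Y \ ⋃ b ∈ F, W b) := by
      ext x
      simp only [Set.mem_union, Set.mem_sdiff, Set.mem_iUnion]
      constructor
      · intro hx
        by_cases hxa : x ∈ W a
        · refine Or.inr ⟨hx, ?_⟩
          rintro ⟨b, hb, hxb⟩
          have : x ∈ Y ∩ W a ∩ W b := ⟨⟨hx, hxa⟩, hxb⟩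
          rw [hdis a (by simp) b (by simp [hb]) (by rintro rfl; exact ha hb)] at this
          exact this
        · exact Or.inl ⟨hx, hxa⟩
      · rintro (h | h) <;> exact h.1
    have e2 : Y \ ⋃ b ∈ insert a F, W b = (Y \ W a) ∩ (Y \ ⋃ b ∈ F, W b) := by
      rw [Finset.set_biUnion_insert, ← Set.sdiff_inter_sdiff]
    have := Good.add (d := d) (s := s) hU hV (by rw [← e1]; exact hg a (by simp)) (by rw [← e1]; exact ih')
    rwa [← e1, ← e2] at this

/-- homotopies -/
theorem htpy (H : C(E × ℝ, E)) (h0 : ∀ x, H (x, 0) = x) : ∃ D : Ch E →ₗ[ℤ] Ch E,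
    (∀ X Y : Set E, (∀ x ∈ X, ∀ t : ℝ, 0 ≤ t → t ≤ 1 → H (x, t) ∈ Y) → ∀ c ∈ sub X, D c ∈ sub Y) ∧
    ∀ c, c = push (H.comp ((ContinuousMap.id E).prodMk (ContinuousMap.const E 1))) c
      - D (dS c) - dS (D c) := by
  let τ : C(Sx 2, ℝ) := ⟨fun t => t.1 1, (continuous_apply 1).comp continuous_subtype_val⟩
  let h : C(E × Sx 2, E) := H.comp ((ContinuousMap.id E).prodMap τ)
  refine ⟨DS h, ?_, ?_⟩
  · intro X Y hXY c hc
    refine DS_sub h (fun x hx t => hXY x hx _ (t.2.1 1) ?_) hc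
    have := t.2.2
    rw [Fin.sum_univ_two] at this
    have h0 := t.2.1 0
    show t.1 1 ≤ 1
    linarith
  · intro c
    have h1 := DS_htpy h c
    have e0 : hEnd h 0 = ContinuousMap.id E := by
      ext x
      show H (x, (vert (0 : Fin 2)).1 1) = x
      simp [vert, h0]
    have e1 : hEnd h 1 = H.comp ((ContinuousMap.id E).prodMk (ContinuousMap.const E 1)) := by
      ext x
      show H (x, (vert (1 : Fin 2)).1 1) = H (x, 1)
      simp [vert]
    have e2 : push (ContinuousMap.id E) c = c := by
      refine (lin_ext (L := push (ContinuousMap.id E)) (L' := LinearMap.id) (fun σ => ?_) c)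
      rw [push, lin_single]; rfl
    rw [e0, e1, e2, add_comm] at h1
    rw [sub_sub, h1]; abel

theorem contr {X A : Set E} (H : C(E × ℝ, E)) (h0 : ∀ x, H (x, 0) = x)
    (hX : ∀ x ∈ X, ∀ t : ℝ, 0 ≤ t → t ≤ 1 → H (x, t) ∈ X)
    (hA : ∀ x ∈ A, ∀ t : ℝ, 0 ≤ t → t ≤ 1 → H (x, t) ∈ A)
    (h1 : ∀ x ∈ X, H (x, 1) ∈ A) {z : Ch E} (hz : z ∈ sub X) (hd : dS z ∈ sub A) : z ∈ Bd X A := by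
  obtain ⟨D, hD, hD'⟩ := htpy H h0
  rw [hD' z]
  refine Submodule.sub_mem _ (Submodule.mem_sup_right (Submodule.sub_mem _ ?_ ?_))
    (Submodule.mem_sup_left ⟨_, hD X X hX z hz, rfl⟩)
  · exact push_sub _ h1 hz
  · exact hD A A hA _ hd

theorem Tr_susp {P U V : Set E} (hU : IsOpen U) (hV : IsOpen V) (hUP : U ⊆ P) (hVP : V ⊆ P)
    (cU : ∀ z ∈ sub P, dS z ∈ sub U → z ∈ Bd P U) (cV : ∀ z ∈ sub P, dS z ∈ sub V → z ∈ Bd P V) :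
    Tr P (U ∪ V) P (U ∩ V) 1 := by
  intro i z h1 h2 h3
  obtain ⟨p, hp, q, hq, e, he, hpi, hqi, h⟩ := small hU hV h3 (by rw [dS_dS]; exact Submodule.zero_mem _)
    (dS_hom h1)
  have hpq : dS p + dS q = 0 := by
    have := congrArg dS h
    rw [dS_dS, map_add, map_add, dS_dS, add_zero] at this
    exact this.symm
  refine ⟨q, hqi, sub_mono hVP hq, sub_inter ?_ (dS_sub hq), fun m => ⟨fun hz => ?_, fun hz => ?_⟩⟩
  · rw [eq_neg_of_add_eq_zero_right hpq]
    exact Submodule.neg_mem _ (dS_sub hp)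
  · obtain ⟨y, hy, a, ha, -, hai, h4⟩ := mem_Bd_hom (Submodule.smul_mem _ m h1) hz
    have he' : dS z = p + q + dS (pj (i + 1) e) := by
      have := congrArg (pj i) h
      rwa [pj_of_mem (dS_hom h1), map_add, map_add, pj_of_mem hpi, pj_of_mem hqi, pj_dS] at this
    have h5 : dS (a - m • pj (i + 1) e) = m • p + m • q := by
      have : dS a = m • dS z := by rw [← map_smul, h4, map_add, dS_dS, zero_add]
      rw [map_sub, map_smul, this, he', smul_add, smul_add]; abel
    obtain ⟨u, hu, v, hv, f, hf, -, -, h6⟩ := small hU hV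
      (Submodule.sub_mem _ ha (Submodule.smul_mem _ m (pj_sub (i + 1) he)))
      (by rw [h5]; exact Submodule.add_mem_sup (Submodule.smul_mem _ _ hp) (Submodule.smul_mem _ _ hq))
      (Submodule.sub_mem _ hai (Submodule.smul_mem _ m (pj_hom (i + 1) e)))
    rw [h6, map_add, map_add, dS_dS, add_zero] at h5
    refine mem_Bd.2 ⟨v, sub_mono hVP hv, m • q - dS v, sub_inter ?_
      (Submodule.sub_mem _ (Submodule.smul_mem _ _ hq) (dS_sub hv)), by abel⟩
    have : m • q - dS v = dS u - m • p := by
      rw [sub_eq_sub_iff_add_eq_add, h5]; abel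
    rw [this]
    exact Submodule.sub_mem _ (dS_sub hu) (Submodule.smul_mem _ _ hp)
  · obtain ⟨y, hy, b, hb, h4⟩ := mem_Bd.1 hz
    have h5 : dS y = m • q - b := by rw [h4]; abel
    obtain ⟨y2, hy2, r, hr, h6⟩ := mem_Bd.1 (cV y hy (by
      rw [h5]
      exact Submodule.sub_mem _ (Submodule.smul_mem _ _ hq) (sub_mono Set.inter_subset_right hb)))
    have h7 : dS y = dS r := by rw [h6, map_add, dS_dS, zero_add]
    have h8 : dS (m • z - m • e - r) = m • p + b := by
      rw [map_sub, map_sub, map_smul, map_smul, h, ← h7, h5, smul_add, smul_add]; abel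
    obtain ⟨y3, hy3, s, hs, h9⟩ := mem_Bd.1 (cU (m • z - m • e - r)
      (Submodule.sub_mem _ (Submodule.sub_mem _ (Submodule.smul_mem _ _ h2)
        (Submodule.smul_mem _ _ (sub_mono (Set.union_subset hUP hVP) he))) (sub_mono hVP hr))
      (by rw [h8]; exact Submodule.add_mem _ (Submodule.smul_mem _ _ hp)
            (sub_mono Set.inter_subset_left hb)))
    refine mem_Bd.2 ⟨y3, hy3, s + m • e + r, Submodule.add_mem _ (Submodule.add_mem _
      (sub_mono Set.subset_union_left hs) (Submodule.smul_mem _ _ he))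
      (sub_mono Set.subset_union_right hr), ?_⟩
    have : m • z = (m • z - m • e - r) + m • e + r := by abel
    rw [this, h9]; abel

theorem Good.step {d : ℕ} {Y A : Set E} (hA : A ⊆ Y) (g0 : Good d 0 Y ∅) (g1 : Good d 1 Y A)
    (H : C(E × ℝ, E)) (h0 : ∀ x, H (x, 0) = x)
    (hX : ∀ x ∈ Y, ∀ t : ℝ, 0 ≤ t → t ≤ 1 → H (x, t) ∈ Y)
    (h1 : ∀ x ∈ Y, H (x, 1) ∈ A) : Good d 0 A ∅ := by
  have surj : ∀ y ∈ sub Y, dS y ∈ sub (∅ : Set E) → y ∈ Bd Y A := by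
    obtain ⟨D, hD, hD'⟩ := htpy H h0
    intro y hy hd
    rw [hD' y]
    refine Submodule.sub_mem _ (Submodule.mem_sup_right (Submodule.sub_mem _ ?_ ?_))
      (Submodule.mem_sup_left ⟨_, hD Y Y hX _ hy, rfl⟩)
    · exact push_sub _ h1 hy
    · exact hD ∅ A (by simp) _ hd
  intro i z hi hz hd
  have fin : ∀ y ∈ sub Y, ∀ b ∈ sub (∅ : Set E), z = dS y + b → y ∈ Bd Y A → z ∈ Bd A ∅ := by
    intro y hy b hb h hyB
    obtain ⟨y2, hy2, a, ha, h2⟩ := mem_Bd.1 hyB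
    refine mem_Bd.2 ⟨a, ha, b, hb, ?_⟩
    rw [h, h2, map_add, dS_dS, zero_add]
  obtain ⟨ga, gb⟩ := g0 i z hi (sub_mono hA hz) hd
  have hdy : ∀ y, ∀ b ∈ sub (∅ : Set E), z = dS y + b → dS y ∈ sub A := by
    intro y b hb h
    have : dS y = z - b := by rw [h]; abel
    rw [this]
    exact Submodule.sub_mem _ hz (sub_mono (Set.empty_subset _) hb)
  constructor
  · intro m hm hmz
    obtain ⟨y, hy, b, hb, hyi, -, h⟩ := mem_Bd_hom hi (ga m hm (Bd_mono hA subset_rfl hmz))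
    refine fin y hy b hb h ((g1 (i + 1) y hyi hy (hdy y b hb h)).1 m hm ?_)
    obtain ⟨w, hw, b', hb', h'⟩ := mem_Bd.1 hmz
    have h3 : dS (m • y - w) = b' - m • b := by
      have : dS w = m • z - b' := by rw [h']; abel
      rw [map_sub, map_smul, this, h, smul_add]; abel
    have h4 := surj (m • y - w) (Submodule.sub_mem _ (Submodule.smul_mem _ _ hy) (sub_mono hA hw))
      (by rw [h3]; exact Submodule.sub_mem _ hb' (Submodule.smul_mem _ _ hb))
    have : m • y = (m • y - w) + w := by abel
    rw [this]
    exact Submodule.add_mem _ h4 (Submodule.mem_sup_right hw)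
  · intro hn
    obtain ⟨y, hy, b, hb, hyi, -, h⟩ := mem_Bd_hom hi (gb hn)
    refine fin y hy b hb h ((g1 (i + 1) y hyi hy (hdy y b hb h)).2 ?_)
    rintro ⟨t, ht⟩
    exact hn ⟨t, by omega⟩

theorem Good.mono {d s : ℕ} {X A : Set E} (r : ℕ) (h : Good d (s + r * d) X A) : Good d s X A := by
  intro i z h1 h2 h3
  obtain ⟨a, b⟩ := h i z h1 h2 h3
  refine ⟨a, fun hi => b ?_⟩
  rintro ⟨t, ht⟩
  exact hi ⟨r + t, by rw [ht]; ring⟩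

theorem sub_empty_hom {i : ℕ} {a : Ch E} (h1 : a ∈ sub (∅ : Set E)) (h2 : a ∈ hom E (i + 1)) : a = 0 := by
  rw [sub, Finsupp.mem_supported] at h1
  rw [hom, Finsupp.mem_supported] at h2
  rw [← Finsupp.support_eq_empty, Finset.eq_empty_iff_forall_notMem]
  rintro ⟨m, σ⟩ hσ
  have h3 : m = i + 1 := h2 hσ
  subst h3
  exact h1 hσ ⟨vert 0, rfl⟩

/-- the constant simplex -/
noncomputable def cst (p : E) (m : ℕ) : Ch E := bs ⟨m, ContinuousMap.const _ p⟩

theorem bdL_replicate {K : Type} (b : K) (m : ℕ) :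
    bdL (List.replicate (m + 1) b) = if Even m then bs (List.replicate m b) else 0 := by
  induction m with
  | zero => simp [bdL]
  | succ m ih =>
    rw [List.replicate_succ, bdL, ih]
    by_cases h : Even m
    · rw [if_pos h, if_neg (by simp [Nat.even_add_one, h]), cone_bs, ← List.replicate_succ, sub_self]
    · rw [if_neg h, if_pos (by simp [Nat.even_add_one, h]), map_zero, sub_zero]

theorem reL_cst (p : E) (m : ℕ) :
    re (ContinuousMap.const (Sx 1) p) (bs (List.replicate m (vert 0))) = cst p m := by
  rw [re_bs, ← List.ofFn_const, reL_ofFn]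
  rfl

theorem dS_cst (p : E) (m : ℕ) : dS (cst p (m + 1)) = if Even m then cst p m else 0 := by
  rw [← reL_cst, dS_re, bd_bs, bdL_replicate]
  split_ifs
  · rw [reL_cst]
  · rw [map_zero]

theorem push_const (p : E) (m : ℕ) {c : Ch E} (hc : c ∈ hom E m) :
    ∃ q : ℤ, push (ContinuousMap.const E p) c = q • cst p m := by
  have : push (ContinuousMap.const E p) c ∈ Submodule.span ℤ {cst p m} := by
    refine supp_induct _ _ _ (fun σ hσ => ?_) hc
    obtain ⟨n, σ⟩ := σ
    have : n = m := hσ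
    subst this
    rw [push, lin_single]
    exact Submodule.mem_span_singleton_self _
  obtain ⟨q, hq⟩ := Submodule.mem_span_singleton.1 this
  exact ⟨q, hq.symm⟩

theorem Good.base (d : ℕ) (p : E) (H : C(E × ℝ, E)) (h0 : ∀ x, H (x, 0) = x) (h1 : ∀ x, H (x, 1) = p) :
    Good d 0 (Set.univ : Set E) ∅ := by
  obtain ⟨D, hD, hD'⟩ := htpy H h0
  have e1 : H.comp ((ContinuousMap.id E).prodMk (ContinuousMap.const E 1)) = ContinuousMap.const E p := by
    ext x; exact h1 x
  rw [e1] at hD'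
  intro i z hi hz hd
  obtain ⟨q, hq⟩ := push_const p (i + 1) hi
  have hu : ∀ c : Ch E, c ∈ sub Set.univ := fun c => by simp [sub]
  have hzq : z - q • cst p (i + 1) ∈ Bd Set.univ ∅ := by
    have h3 := hD' z
    rw [hq] at h3
    have : z - q • cst p (i + 1) = - D (dS z) - dS (D z) := by
      rw [sub_eq_iff_eq_add]; conv_lhs => rw [h3]
      abel
    rw [this]
    exact Submodule.sub_mem _ (Submodule.neg_mem _ (Submodule.mem_sup_right (hD ∅ ∅ (by simp) _ hd)))
      (Submodule.mem_sup_left ⟨_, hu _, rfl⟩)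
  have red : q • cst p (i + 1) ∈ Bd (Set.univ : Set E) ∅ → z ∈ Bd Set.univ ∅ := by
    intro h
    have := Submodule.add_mem _ hzq h
    rwa [sub_add_cancel] at this
  have hq0 : ∀ m i : ℕ, ∀ q : ℤ, q • cst p m = 0 → q = 0 := by
    intro m i q h
    rw [cst, bs, Finsupp.smul_single, Finsupp.single_eq_zero] at h
    simpa using h
  by_cases hev : Even i
  · rcases i with _ | i
    · refine ⟨fun m hm hmz => red ?_, fun h => absurd ⟨0, by simp⟩ h⟩
      have h5 : (m * q) • cst p 1 ∈ Bd (Set.univ : Set E) ∅ := by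
        have := Submodule.sub_mem _ hmz (Submodule.smul_mem _ m hzq)
        rwa [smul_sub, sub_sub_cancel, smul_smul] at this
      have hc : cst p 1 ∈ hom E 1 := Finsupp.single_mem_supported _ _ rfl
      obtain ⟨y, hy, a, ha, -, hai, h6⟩ := mem_Bd_hom (Submodule.smul_mem _ (m * q) hc) h5
      rw [sub_empty_hom ha hai, add_zero] at h6
      have h7 := congrArg dS h6
      rw [dS_dS, map_smul, dS_cst, if_pos hev] at h7
      have := hq0 _ 0 _ h7
      rcases mul_eq_zero.1 this with h | h
      · exact absurd h hm
      · rw [h, zero_smul]; exact Submodule.zero_mem _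
    · have h5 : push (ContinuousMap.const E p) (dS z) ∈ sub (∅ : Set E) := push_sub _ (by simp) hd
      rw [push_dS, hq] at h5
      have h6 := sub_empty_hom h5 (dS_hom (Submodule.smul_mem _ q
        (Finsupp.single_mem_supported _ _ rfl : cst p (i + 1 + 1) ∈ hom E (i + 1 + 1))))
      rw [map_smul, dS_cst, if_pos hev] at h6
      have h7 := red (by rw [hq0 _ 0 _ h6, zero_smul]; exact Submodule.zero_mem _)
      exact ⟨fun _ _ _ => h7, fun _ => h7⟩
  · have h7 := red (Submodule.smul_mem _ _ (Submodule.mem_sup_left ⟨cst p (i + 2), hu _, by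
      rw [dS_cst, if_pos (by simp [Nat.even_add_one, hev])]⟩))
    exact ⟨fun _ _ _ => h7, fun _ => h7⟩

end TB

namespace TB
variable {n : ℕ}

noncomputable def moveH (j : Fin n) (f : C((Fin n → ℝ), ℝ)) : C((Fin n → ℝ) × ℝ, Fin n → ℝ) where
  toFun p := Function.update p.1 j (p.1 j + p.2 * f p.1)
  continuous_toFun := by fun_prop

theorem moveH_apply (j : Fin n) (f : C((Fin n → ℝ), ℝ)) (x : Fin n → ℝ) (t : ℝ) :
    moveH j f (x, t) = Function.update x j (x j + t * f x) := rfl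

theorem moveH_zero (j : Fin n) (f : C((Fin n → ℝ), ℝ)) (x : Fin n → ℝ) : moveH j f (x, 0) = x := by
  simp [moveH_apply]

theorem Good.suspend {d s : ℕ} {P Q : Set (Fin n → ℝ)} (hP : IsOpen P) (hQ : IsClosed Q) (j : Fin n)
    (iP : ∀ x ∈ P, ∀ c, Function.update x j c ∈ P) (iQ : ∀ x ∈ Q, ∀ c, Function.update x j c ∈ Q)
    (g : (Fin n → ℝ) → ℝ) (hg : Continuous g) (ig : ∀ x c, g (Function.update x j c) = g x)
    (h : Good d s P (P \ Q)) : Good d (s + 1) P (P \ (Q ∩ {x | x j = g x})) := by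
  have iQ' : ∀ x c, Function.update x j c ∈ Q → x ∈ Q := by
    intro x c hx
    have := iQ _ hx (x j)
    simpa using this
  let U := P \ (Q ∩ {x | x j ≤ g x})
  let V := P \ (Q ∩ {x | g x ≤ x j})
  have hU : IsOpen U := hP.sdiff (hQ.inter (isClosed_le (by fun_prop) hg))
  have hV : IsOpen V := hP.sdiff (hQ.inter (isClosed_le hg (by fun_prop)))
  have e1 : U ∩ V = P \ Q := by
    ext x
    simp only [U, V, Set.mem_inter_iff, Set.mem_sdiff, Set.mem_ofPred_eq]
    constructor
    · rintro ⟨⟨a, b⟩, -, c⟩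
      exact ⟨a, fun hq => (le_total (x j) (g x)).elim (fun h => b ⟨hq, h⟩) (fun h => c ⟨hq, h⟩)⟩
    · rintro ⟨a, b⟩
      exact ⟨⟨a, fun h => b h.1⟩, a, fun h => b h.1⟩
  have e2 : U ∪ V = P \ (Q ∩ {x | x j = g x}) := by
    ext x
    simp only [U, V, Set.mem_inter_iff, Set.mem_union, Set.mem_sdiff, Set.mem_ofPred_eq]
    constructor
    · rintro (⟨a, b⟩ | ⟨a, b⟩)
      · exact ⟨a, fun h => b ⟨h.1, h.2.le⟩⟩
      · exact ⟨a, fun h => b ⟨h.1, h.2.ge⟩⟩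
    · rintro ⟨a, b⟩
      by_cases hx : x j ≤ g x
      · exact Or.inr ⟨a, fun h => b ⟨h.1, le_antisymm hx h.2⟩⟩
      · exact Or.inl ⟨a, fun h => hx h.2⟩
  rw [← e1] at h
  rw [← e2]
  refine (Tr_susp hU hV Set.sdiff_subset Set.sdiff_subset ?_ ?_).good1 h
  · intro z hz hd
    refine contr (moveH j ⟨fun x => 1 - (x j - g x), by fun_prop⟩) (moveH_zero _ _)
      (fun x hx t _ _ => iP x hx _) ?_ ?_ hz hd
    · rintro x ⟨hx, hx'⟩ t ht0 ht1
      refine ⟨iP x hx _, ?_⟩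
      rintro ⟨hq, hle⟩
      rw [moveH_apply] at hq hle
      have hq' := iQ' _ _ hq
      have h2 : g x < x j := not_le.1 (fun h => hx' ⟨hq', h⟩)
      simp only [ContinuousMap.coe_mk, Set.mem_ofPred_eq, Function.update_self, ig] at hle
      rcases eq_or_lt_of_le ht1 with rfl | ht1
      · linarith
      · nlinarith
    · intro x hx
      refine ⟨iP x hx _, ?_⟩
      rintro ⟨hq, hle⟩
      rw [moveH_apply] at hle
      simp only [ContinuousMap.coe_mk, Set.mem_ofPred_eq, Function.update_self, ig] at hle
      linarith
  · intro z hz hd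
    refine contr (moveH j ⟨fun x => -1 - (x j - g x), by fun_prop⟩) (moveH_zero _ _)
      (fun x hx t _ _ => iP x hx _) ?_ ?_ hz hd
    · rintro x ⟨hx, hx'⟩ t ht0 ht1
      refine ⟨iP x hx _, ?_⟩
      rintro ⟨hq, hle⟩
      rw [moveH_apply] at hq hle
      have hq' := iQ' _ _ hq
      have h2 : x j < g x := not_le.1 (fun h => hx' ⟨hq', h⟩)
      simp only [ContinuousMap.coe_mk, Set.mem_ofPred_eq, Function.update_self, ig] at hle
      rcases eq_or_lt_of_le ht1 with rfl | ht1
      · linarith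
      · nlinarith
    · intro x hx
      refine ⟨iP x hx _, ?_⟩
      rintro ⟨hq, hle⟩
      rw [moveH_apply] at hle
      simp only [ContinuousMap.coe_mk, Set.mem_ofPred_eq, Function.update_self, ig] at hle
      linarith

theorem Good.thom {d : ℕ} {P : Set (Fin n → ℝ)} (hP : IsOpen P) (B : Finset (Fin n))
    (g : Fin n → (Fin n → ℝ) → ℝ) (hg : ∀ i, Continuous (g i))
    (ig : ∀ i, ∀ j ∈ B, ∀ x c, g i (Function.update x j c) = g i x)
    (iP : ∀ x ∈ P, ∀ j ∈ B, ∀ c, Function.update x j c ∈ P) (h : Good d 0 P ∅) :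
    Good d B.card P (P \ {x | ∀ i ∈ B, x i = g i x}) := by
  have key : ∀ C : Finset (Fin n), C ⊆ B → Good d C.card P (P \ {x | ∀ i ∈ C, x i = g i x}) := by
    intro C
    induction C using Finset.induction_on with
    | empty => intro _; simpa using h
    | insert j C hj ih =>
      intro hC
      have hjB : j ∈ B := hC (by simp)
      rw [Finset.card_insert_of_notMem hj]
      have hcl : IsClosed {x : Fin n → ℝ | ∀ i ∈ C, x i = g i x} := by
        simp only [Set.ofPred_forall]
        exact isClosed_iInter fun i => isClosed_iInter fun _ => isClosed_eq (by fun_prop) (hg i)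
      have := Good.suspend hP hcl j (fun x hx c => iP x hx j hjB c) (by
        intro x hx c i hi
        rw [ig i j hjB, Function.update_of_ne (by rintro rfl; exact hj hi)]
        exact hx i hi) (g j) (hg j) (ig j j hjB) (ih ((Finset.subset_insert _ _).trans hC))
      convert this using 2
      ext x
      simp [and_comm]
  exact key B subset_rfl

end TB

namespace TB
variable {n : ℕ}

theorem Good.local {d s : ℕ} {Y O L : Set (Fin n → ℝ)} (hY : IsOpen Y) (hO : IsOpen O) (hL : IsClosed L)
    (h : Y ∩ L = O ∩ L) (hg : Good d s O (O \ L)) : Good d s Y (Y \ L) := by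
  have hYO : ∀ x ∈ L, x ∈ Y ↔ x ∈ O := by
    intro x hx
    constructor
    · intro hy
      have : x ∈ Y ∩ L := ⟨hy, hx⟩
      rw [h] at this; exact this.1
    · intro hy
      have : x ∈ O ∩ L := ⟨hy, hx⟩
      rw [← h] at this; exact this.1
  have hN : IsOpen (Y ∩ O) := hY.inter hO
  have t1 := Tr_exc2 hN (hO.sdiff hL)
  have t2 := Tr_exc1 hN (hY.sdiff hL)
  have e1 : (Y ∩ O) ∪ (O \ L) = O := by
    ext x
    have := hYO x
    simp only [Set.mem_union, Set.mem_inter_iff, Set.mem_sdiff]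
    tauto
  have e2 : (Y ∩ O) ∪ (Y \ L) = Y := by
    ext x
    have := hYO x
    simp only [Set.mem_union, Set.mem_inter_iff, Set.mem_sdiff]
    tauto
  have e3 : (Y ∩ O) ∩ (O \ L) = (Y ∩ O) ∩ (Y \ L) := by
    ext x
    simp only [Set.mem_inter_iff, Set.mem_sdiff]
    tauto
  rw [e1, e3] at t1
  rw [e2] at t2
  exact t2.good0 (t1.good0 hg)

/-- weight of the coordinates in `J` with absolute value `r` -/
noncomputable def wt (J : Finset (Fin n)) (w : Fin n → ℕ) (w0 : ℕ) (x : Fin n → ℝ) (r : ℝ) : ℕ :=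
  (if r = 0 then w0 else 0) + ∑ i ∈ J, if |x i| = r then w i else 0

def XX (k : ℕ) (J : Finset (Fin n)) (w : Fin n → ℕ) (w0 : ℕ) : Set (Fin n → ℝ) :=
  {x | ∀ r, wt J w w0 x r < k}

theorem mem_XX_iff {k : ℕ} (hk : 1 ≤ k) (J : Finset (Fin n)) (w : Fin n → ℕ) (w0 : ℕ) (x : Fin n → ℝ) :
    x ∈ XX k J w w0 ↔ ∀ B ⊆ J, (k ≤ ∑ i ∈ B, w i → ¬ ∀ i ∈ B, ∀ j ∈ B, |x i| = |x j|) ∧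
      (k ≤ w0 + ∑ i ∈ B, w i → ¬ ∀ i ∈ B, x i = 0) := by
  have hle : ∀ B ⊆ J, ∀ r, (∀ i ∈ B, |x i| = r) →
      (if r = 0 then w0 else 0) + ∑ i ∈ B, w i ≤ wt J w w0 x r := by
    intro B hB r hr
    rw [wt]
    refine Nat.add_le_add_left ?_ _
    calc ∑ i ∈ B, w i = ∑ i ∈ B, if |x i| = r then w i else 0 :=
          Finset.sum_congr rfl (fun i hi => by rw [if_pos (hr i hi)])
      _ ≤ _ := Finset.sum_le_sum_of_subset hB
  constructor
  · intro hx B hB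
    refine ⟨fun hw hr => ?_, fun hw hr => ?_⟩
    · rcases B.eq_empty_or_nonempty with rfl | ⟨i0, hi0⟩
      · simp at hw; omega
      · have h1 := hle B hB |x i0| (fun i hi => hr i hi i0 hi0)
        have h2 := hx |x i0|
        omega
    · have h1 := hle B hB 0 (fun i hi => by rw [hr i hi, abs_zero])
      have h2 := hx 0
      simp only [if_true] at h1
      omega
  · intro h r
    by_contra hr
    rw [not_lt] at hr
    rw [wt, ← Finset.sum_filter] at hr
    obtain ⟨h1, h2⟩ := h (J.filter (fun i => |x i| = r)) (Finset.filter_subset _ _)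
    split_ifs at hr with h0
    · refine h2 hr (fun i hi => ?_)
      have := (Finset.mem_filter.1 hi).2
      rw [h0] at this
      exact abs_eq_zero.1 this
    · refine h1 (by simpa using hr) (fun i hi j hj => ?_)
      rw [(Finset.mem_filter.1 hi).2, (Finset.mem_filter.1 hj).2]

theorem isOpen_XX {k : ℕ} (hk : 1 ≤ k) (J : Finset (Fin n)) (w : Fin n → ℕ) (w0 : ℕ) :
    IsOpen (XX k J w w0) := by
  have : XX k J w w0 = ⋂ B ∈ J.powerset, (({x | k ≤ ∑ i ∈ B, w i → ¬ ∀ i ∈ B, ∀ j ∈ B, |x i| = |x j|}) ∩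
      {x | k ≤ w0 + ∑ i ∈ B, w i → ¬ ∀ i ∈ B, x i = 0}) := by
    ext x
    rw [mem_XX_iff hk]
    simp only [Set.mem_iInter, Finset.mem_powerset]
    rfl
  rw [this]
  refine isOpen_biInter_finset (fun B _ => IsOpen.inter ?_ ?_)
  · by_cases h : k ≤ ∑ i ∈ B, w i
    · simp only [h, true_imp_iff]
      refine IsClosed.isOpen_compl (s := {x : Fin n → ℝ | ∀ i ∈ B, ∀ j ∈ B, |x i| = |x j|}) (self := ?_)
      simp only [Set.ofPred_forall]
      exact isClosed_iInter fun i => isClosed_iInter fun _ => isClosed_iInter fun j =>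
        isClosed_iInter fun _ => isClosed_eq (by fun_prop) (by fun_prop)
    · simp [h]
  · by_cases h : k ≤ w0 + ∑ i ∈ B, w i
    · simp only [h, true_imp_iff]
      refine IsClosed.isOpen_compl (s := {x : Fin n → ℝ | ∀ i ∈ B, x i = 0}) (self := ?_)
      simp only [Set.ofPred_forall]
      exact isClosed_iInter fun i => isClosed_iInter fun _ => isClosed_eq (by fun_prop) (by fun_prop)
    · simp [h]

theorem wt_update {J : Finset (Fin n)} {j : Fin n} (hj : j ∉ J) (w : Fin n → ℕ) (w0 : ℕ) (x : Fin n → ℝ)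
    (c r : ℝ) : wt J w w0 (Function.update x j c) r = wt J w w0 x r := by
  rw [wt, wt]
  congr 1
  refine Finset.sum_congr rfl (fun i hi => ?_)
  rw [Function.update_of_ne (by rintro rfl; exact hj hi)]

theorem XX_update {k : ℕ} {J : Finset (Fin n)} {j : Fin n} (hj : j ∉ J) {w : Fin n → ℕ} {w0 : ℕ}
    {x : Fin n → ℝ} (hx : x ∈ XX k J w w0) (c : ℝ) : Function.update x j c ∈ XX k J w w0 := by
  intro r
  rw [wt_update hj]
  exact hx r

theorem typeB_eq {k : ℕ} (hk : 3 ≤ k) :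
    {x : Fin n → ℝ | (∀ S : Finset (Fin n), S.card = k → ∀ ε : Fin n → ℝ, (∀ i, ε i = 1 ∨ ε i = -1) →
          ¬ (∀ i ∈ S, ∀ j ∈ S, ε i * x i = ε j * x j)) ∧
       (∀ S : Finset (Fin n), S.card = k - 1 → ¬ (∀ i ∈ S, x i = 0))} =
    XX k Finset.univ (fun _ => 1) 1 := by
  ext x
  rw [mem_XX_iff (by omega)]
  simp only [Set.mem_ofPred_eq, Finset.subset_univ, true_imp_iff, Finset.sum_const, smul_eq_mul, mul_one]
  constructor
  · rintro ⟨h1, h2⟩ B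
    refine ⟨fun hB hx => ?_, fun hB hx => ?_⟩
    · obtain ⟨S, hS, hSk⟩ := Finset.exists_subset_card_eq hB
      refine h1 S hSk (fun i => if 0 ≤ x i then 1 else -1) (fun i => by split_ifs <;> simp) ?_
      have : ∀ i, (if 0 ≤ x i then (1 : ℝ) else -1) * x i = |x i| := by
        intro i
        split_ifs with h
        · rw [one_mul, abs_of_nonneg h]
        · rw [abs_of_neg (not_le.1 h)]; ring
      intro i hi j hj
      simp only [this]
      exact hx i (hS hi) j (hS hj)
    · obtain ⟨S, hS, hSk⟩ := Finset.exists_subset_card_eq (show k - 1 ≤ B.card by omega)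
      exact h2 S hSk (fun i hi => hx i (hS hi))
  · intro h
    refine ⟨fun S hS ε hε hx => (h S).1 hS.ge (fun i hi j hj => ?_), fun S hS hx => (h S).2 (by omega) hx⟩
    have e : ∀ i, |ε i * x i| = |x i| := by
      intro i
      rw [abs_mul]
      rcases hε i with h | h <;> simp [h]
    rw [← e i, ← e j, hx i hi j hj]

end TB

namespace TB
variable {n : ℕ}

/-- the linear pieces -/
def LL (a : Fin n) (α : Finset (Fin n) × Option (Finset (Fin n))) : Set (Fin n → ℝ) :=
  match α with
  | (B, some N) => {x | ∀ i ∈ B, x i = (if i ∈ N then -1 else 1) * x a}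
  | (B, none) => {x | ∀ i ∈ insert a B, x i = 0}

def adm (k : ℕ) (J : Finset (Fin n)) (w : Fin n → ℕ) (w0 : ℕ)
    (α : Finset (Fin n) × Option (Finset (Fin n))) : Prop :=
  match α with
  | (B, some N) => B ⊆ J ∧ N ⊆ B ∧ ∑ i ∈ B, w i = k - 1
  | (B, none) => B ⊆ J ∧ w0 + ∑ i ∈ B, w i = k - 1

theorem LL_closed (a : Fin n) (α : Finset (Fin n) × Option (Finset (Fin n))) : IsClosed (LL a α) := by
  obtain ⟨B, _ | N⟩ := α
  · simp only [LL, Set.ofPred_forall]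
    exact isClosed_iInter fun i => isClosed_iInter fun _ => isClosed_eq (by fun_prop) (by fun_prop)
  · simp only [LL, Set.ofPred_forall]
    exact isClosed_iInter fun i => isClosed_iInter fun _ => isClosed_eq (by fun_prop) (by fun_prop)

open Classical in
/-- the index of the piece containing `x` -/
noncomputable def idx (a : Fin n) (J : Finset (Fin n)) (x : Fin n → ℝ) :
    Finset (Fin n) × Option (Finset (Fin n)) :=
  (J.filter (fun i => |x i| = |x a|), if x a = 0 then none else
    some (J.filter (fun i => x i = - x a)))

theorem wt_ge {J B : Finset (Fin n)} (hB : B ⊆ J) (w : Fin n → ℕ) (w0 : ℕ) (x : Fin n → ℝ) (r : ℝ)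
    (hr : ∀ i ∈ B, |x i| = r) : (if r = 0 then w0 else 0) + ∑ i ∈ B, w i ≤ wt J w w0 x r := by
  rw [wt]
  refine Nat.add_le_add_left ?_ _
  calc ∑ i ∈ B, w i = ∑ i ∈ B, if |x i| = r then w i else 0 :=
        Finset.sum_congr rfl (fun i hi => by rw [if_pos (hr i hi)])
    _ ≤ _ := Finset.sum_le_sum_of_subset hB

theorem filter_eq {J B : Finset (Fin n)} (hB : B ⊆ J) (w : Fin n → ℕ) (hw : ∀ i ∈ J, 1 ≤ w i) (w0 : ℕ)
    (x : Fin n → ℝ) (r : ℝ) (hr : ∀ i ∈ B, |x i| = r)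
    (h : wt J w w0 x r ≤ (if r = 0 then w0 else 0) + ∑ i ∈ B, w i) :
    J.filter (fun i => |x i| = r) = B := by
  have hsub : B ⊆ J.filter (fun i => |x i| = r) := fun i hi => Finset.mem_filter.2 ⟨hB hi, hr i hi⟩
  by_contra hne
  have hss : B ⊂ J.filter (fun i => |x i| = r) := lt_of_le_of_ne hsub (Ne.symm hne)
  obtain ⟨j, hj, hjB⟩ := Finset.exists_of_ssubset hss
  have h1 : ∑ i ∈ B, w i < ∑ i ∈ J.filter (fun i => |x i| = r), w i :=
    Finset.sum_lt_sum_of_subset hsub hj hjB (hw j (Finset.mem_filter.1 hj).1) (fun _ _ _ => Nat.zero_le _)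
  rw [wt, ← Finset.sum_filter] at h
  omega

theorem piece_eq {k : ℕ} (hk : 3 ≤ k) {J : Finset (Fin n)} {a : Fin n} {w : Fin n → ℕ}
    (hw : ∀ i ∈ J, 1 ≤ w i) {w0 : ℕ} (hw0 : 1 ≤ w0) {x : Fin n → ℝ} (hx : x ∈ XX k J w w0)
    {α : Finset (Fin n) × Option (Finset (Fin n))} (hα : adm k J w w0 α) (hxL : x ∈ LL a α) :
    α = idx a J x ∧ wt J w w0 x |x a| = k - 1 := by
  have hxa := hx |x a|
  obtain ⟨B, _ | N⟩ := α
  · obtain ⟨hB, hs⟩ := hα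
    have hxa0 : x a = 0 := hxL a (by simp)
    have hr : ∀ i ∈ B, |x i| = |x a| := fun i hi => by rw [hxa0, hxL i (by simp [hi])]
    have h1 := wt_ge hB w w0 x _ hr
    have h2 := filter_eq hB w hw w0 x _ hr (by simp [hxa0] at *; omega)
    refine ⟨?_, by simp [hxa0] at *; omega⟩
    rw [idx, if_pos hxa0, h2]
  · obtain ⟨hB, hN, hs⟩ := hα
    have hr : ∀ i ∈ B, |x i| = |x a| := fun i hi => by
      rw [hxL i hi, abs_mul]
      split_ifs <;> simp
    have h1 := wt_ge hB w w0 x _ hr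
    have hxa0 : x a ≠ 0 := by
      intro h0
      simp [h0] at *; omega
    have h2 := filter_eq hB w hw w0 x _ hr (by simp [hxa0] at *; omega)
    refine ⟨?_, by simp [hxa0] at *; omega⟩
    rw [idx, if_neg hxa0, h2]
    congr 2
    ext i
    rw [Finset.mem_filter]
    constructor
    · intro hi
      refine ⟨hB (hN hi), ?_⟩
      rw [hxL i (hN hi), if_pos hi]; ring
    · rintro ⟨hiJ, hi⟩
      have hiB : i ∈ B := by
        rw [← h2, Finset.mem_filter]
        exact ⟨hiJ, by rw [hi, abs_neg]⟩
      by_contra hiN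
      have := hxL i hiB
      rw [if_neg hiN, hi] at this
      apply hxa0
      linarith

theorem piece_mem {k : ℕ} {J : Finset (Fin n)} {a : Fin n} {w : Fin n → ℕ}
    {w0 : ℕ} {x : Fin n → ℝ} (h : wt J w w0 x |x a| = k - 1) :
    adm k J w w0 (idx a J x) ∧ x ∈ LL a (idx a J x) := by
  rw [wt, ← Finset.sum_filter] at h
  rw [idx]
  by_cases h0 : x a = 0
  · rw [if_pos h0]
    rw [if_pos (by simp [h0])] at h
    refine ⟨⟨Finset.filter_subset _ _, h⟩, ?_⟩
    intro i hi
    rcases Finset.mem_insert.1 hi with rfl | hi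
    · exact h0
    · have := (Finset.mem_filter.1 hi).2
      rw [h0] at this
      simpa using this
  · rw [if_neg h0]
    rw [if_neg (by simp [h0]), zero_add] at h
    refine ⟨⟨Finset.filter_subset _ _, ?_, h⟩, ?_⟩
    · intro i hi
      rw [Finset.mem_filter] at hi ⊢
      exact ⟨hi.1, by rw [hi.2, abs_neg]⟩
    · intro i hi
      rw [Finset.mem_filter] at hi
      rcases abs_eq_abs.1 hi.2 with h | h
      · rw [if_neg, h, one_mul]
        rw [Finset.mem_filter]
        rintro ⟨-, h'⟩
        apply h0
        linarith
      · rw [if_pos, h]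
        · ring
        · exact Finset.mem_filter.2 ⟨hi.1, h⟩

theorem wt_split {J B : Finset (Fin n)} (hB : B ⊆ J) (w : Fin n → ℕ) (w0 : ℕ) (x : Fin n → ℝ) (r : ℝ)
    (s : ℝ) (hs : ∀ i ∈ B, |x i| = s) :
    wt J w w0 x r = wt (J \ B) w w0 x r + if s = r then ∑ i ∈ B, w i else 0 := by
  rw [wt, wt, add_assoc]
  congr 1
  rw [← Finset.sum_sdiff hB]
  congr 1
  split_ifs with h
  · exact Finset.sum_congr rfl (fun i hi => by rw [if_pos ((hs i hi).trans h)])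
  · exact Finset.sum_eq_zero (fun i hi => by rw [if_neg (by rw [hs i hi]; exact h)])

theorem codim1 {k : ℕ} (hk : 3 ≤ k) {B : Finset (Fin n)} {w : Fin n → ℕ}
    (hw : ∀ i ∈ B, w i = 1 ∨ w i = k - 1) (hs : ∑ i ∈ B, w i = k - 1) :
    B.card = 1 ∨ B.card = k - 1 := by
  by_cases h : ∀ i ∈ B, w i = 1
  · right
    rw [← hs, Finset.sum_congr rfl h]; simp
  · left
    push Not at h
    obtain ⟨i, hi, hi1⟩ := h
    have hik := (hw i hi).resolve_left hi1
    rw [← Finset.add_sum_erase _ _ hi, hik] at hs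
    have h0 : ∑ j ∈ B.erase i, w j = 0 := by omega
    rw [Finset.sum_eq_zero_iff] at h0
    have : B.erase i = ∅ := by
      rw [Finset.eq_empty_iff_forall_notMem]
      intro j hj
      have := h0 j hj
      have := hw j (Finset.mem_of_mem_erase hj)
      omega
    have h2 := Finset.card_erase_add_one hi
    rw [this] at h2
    simpa using h2.symm

theorem codim2 {k : ℕ} (hk : 3 ≤ k) {B : Finset (Fin n)} {w : Fin n → ℕ} {w0 : ℕ}
    (hw : ∀ i ∈ B, w i = 1 ∨ w i = k - 1) (hw0 : w0 = 1 ∨ w0 = k - 1) (hs : w0 + ∑ i ∈ B, w i = k - 1) :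
    B.card + 1 = 1 ∨ B.card + 1 = k - 1 := by
  have hle : ∀ i ∈ B, w i ≤ ∑ i ∈ B, w i := fun i hi =>
    Finset.single_le_sum (f := w) (fun _ _ => Nat.zero_le _) hi
  rcases hw0 with h | h
  · right
    have : ∀ i ∈ B, w i = 1 := by
      intro i hi
      have := hle i hi
      have := hw i hi
      omega
    rw [Finset.sum_congr rfl this] at hs
    simp at hs
    omega
  · left
    have : B = ∅ := by
      rw [Finset.eq_empty_iff_forall_notMem]
      intro i hi
      have := hle i hi
      have := hw i hi
      omega
    simp [this]

theorem Good.one_of {k c : ℕ} (hk : 3 ≤ k) {X A : Set (Fin n → ℝ)} (hc : c = 1 ∨ c = k - 1)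
    (h : Good (k - 2) c X A) : Good (k - 2) 1 X A := by
  rcases hc with rfl | rfl
  · exact h
  · refine Good.mono 1 ?_
    convert h using 1
    omega

theorem piece_good {k : ℕ} (hk : 3 ≤ k) {J : Finset (Fin n)} {a : Fin n} (ha : a ∉ J) {w : Fin n → ℕ}
    (hw : ∀ i ∈ J, w i = 1 ∨ w i = k - 1) {w0 : ℕ} (hw0 : w0 = 1 ∨ w0 = k - 1)
    (ih : ∀ (J' : Finset (Fin n)) (w' : Fin n → ℕ) (w0' : ℕ), J'.card ≤ J.card →
      (∀ i ∈ J', w' i = 1 ∨ w' i = k - 1) → (w0' = 1 ∨ w0' = k - 1) → Good (k - 2) 0 (XX k J' w' w0') ∅)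
    {α : Finset (Fin n) × Option (Finset (Fin n))} (hα : adm k J w w0 α) :
    Good (k - 2) 1 (XX k J w w0) (XX k J w w0 \ LL a α) := by
  obtain ⟨B, _ | N⟩ := α
  · obtain ⟨hB, hs⟩ := hα
    have haB : a ∉ B := fun h => ha (hB h)
    refine Good.one_of hk (codim2 hk (fun i hi => hw i (hB hi)) hw0 hs) ?_
    refine Good.local (O := XX k (J \ B) w (k - 1)) (isOpen_XX (by omega) _ _ _)
      (isOpen_XX (by omega) _ _ _) (LL_closed _ _) ?_ ?_
    · ext x
      refine and_congr_left (fun hx => forall_congr' (fun r => ?_))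
      have h1 : ∀ i ∈ B, |x i| = 0 := fun i hi => by rw [hx i (by simp [hi]), abs_zero]
      rw [wt_split hB w w0 x r 0 h1, wt, wt]
      have : (if r = 0 then w0 else 0) + (∑ i ∈ J \ B, if |x i| = r then w i else 0) +
          (if 0 = r then ∑ i ∈ B, w i else 0) =
          (if r = 0 then k - 1 else 0) + ∑ i ∈ J \ B, if |x i| = r then w i else 0 := by
        by_cases hr : r = 0
        · subst hr; simp only [if_true]; omega
        · rw [if_neg hr, if_neg hr, if_neg (Ne.symm hr)]; omega
      rw [this]
    · rw [← Finset.card_insert_of_notMem haB]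
      refine Good.thom (isOpen_XX (by omega) _ _ _) (insert a B) (fun _ _ => 0) (fun _ => continuous_const)
        (fun _ _ _ _ _ => rfl) (fun x hx j hj c => XX_update ?_ hx c)
        (ih _ _ _ (Finset.card_le_card Finset.sdiff_subset) (fun i hi => hw i (Finset.sdiff_subset hi))
          (Or.inr rfl))
      rw [Finset.mem_sdiff]
      rcases Finset.mem_insert.1 hj with rfl | hj
      · exact fun h => ha h.1
      · exact fun h => h.2 hj
  · obtain ⟨hB, hN, hs⟩ := hα
    have haB : a ∉ B := fun h => ha (hB h)
    have haJ : a ∉ J \ B := fun h => ha (Finset.mem_sdiff.1 h).1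
    refine Good.one_of hk (codim1 hk (fun i hi => hw i (hB hi)) hs) ?_
    refine Good.local (O := XX k (insert a (J \ B)) (Function.update w a (k - 1)) w0)
      (isOpen_XX (by omega) _ _ _) (isOpen_XX (by omega) _ _ _) (LL_closed _ _) ?_ ?_
    · ext x
      refine and_congr_left (fun hx => forall_congr' (fun r => ?_))
      have h1 : ∀ i ∈ B, |x i| = |x a| := fun i hi => by
        rw [hx i hi, abs_mul]
        split_ifs <;> simp
      rw [wt_split hB w w0 x r _ h1, wt, wt, Finset.sum_insert haJ, Function.update_self, hs]
      have : ∑ i ∈ J \ B, (if |x i| = r then Function.update w a (k - 1) i else 0) =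
          ∑ i ∈ J \ B, if |x i| = r then w i else 0 := by
        refine Finset.sum_congr rfl (fun i hi => ?_)
        rw [Function.update_of_ne (by rintro rfl; exact haJ hi)]
      rw [this, add_assoc, add_comm (∑ i ∈ J \ B, _)]
    · refine Good.thom (isOpen_XX (by omega) _ _ _) B (fun i x => (if i ∈ N then -1 else 1) * x a)
        (fun _ => by fun_prop) (fun i j hj x c => ?_) (fun x hx j hj c => XX_update ?_ hx c)
        (ih _ _ _ ?_ ?_ hw0)
      · rw [Function.update_of_ne (by rintro rfl; exact haB hj)]
      · rw [Finset.mem_insert, Finset.mem_sdiff]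
        rintro (rfl | h)
        · exact haB hj
        · exact h.2 hj
      · rw [Finset.card_insert_of_notMem haJ, Finset.card_sdiff_of_subset hB]
        have hne : B.Nonempty := by
          rw [Finset.nonempty_iff_ne_empty]
          rintro rfl
          simp at hs
          omega
        have := hne.card_pos
        have := Finset.card_le_card hB
        omega
      · intro i hi
        rcases Finset.mem_insert.1 hi with rfl | hi
        · right; simp
        · rw [Function.update_of_ne (ne_of_mem_of_not_mem hi haJ)]
          exact hw i (Finset.mem_sdiff.1 hi).1

theorem good_step {k : ℕ} (hk : 3 ≤ k) {J : Finset (Fin n)} {a : Fin n} (ha : a ∉ J) {w : Fin n → ℕ}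
    (hw : ∀ i ∈ J, w i = 1 ∨ w i = k - 1) {w0 : ℕ} (hw0 : w0 = 1 ∨ w0 = k - 1)
    (key : ∀ x ∈ XX k J w w0, ∀ r, k ≤ wt J w w0 x r + w a ↔ wt J w w0 x r = k - 1)
    (ih : ∀ (J' : Finset (Fin n)) (w' : Fin n → ℕ) (w0' : ℕ), J'.card ≤ J.card →
      (∀ i ∈ J', w' i = 1 ∨ w' i = k - 1) → (w0' = 1 ∨ w0' = k - 1) → Good (k - 2) 0 (XX k J' w' w0') ∅) :
    Good (k - 2) 0 (XX k (insert a J) w w0) ∅ := by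
  classical
  have hwt : ∀ x r, wt (insert a J) w w0 x r = wt J w w0 x r + if |x a| = r then w a else 0 := by
    intro x r
    rw [wt, wt, Finset.sum_insert ha]; ring
  have hX : ∀ x, x ∈ XX k (insert a J) w w0 ↔ x ∈ XX k J w w0 ∧ wt J w w0 x |x a| ≠ k - 1 := by
    intro x
    constructor
    · intro h
      have h1 : x ∈ XX k J w w0 := fun r => by
        have := h r
        rw [hwt] at this
        omega
      refine ⟨h1, fun h2 => ?_⟩
      have := (key x h1 _).2 h2
      have h3 := h |x a|
      rw [hwt, if_pos rfl] at h3
      omega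
    · rintro ⟨h1, h2⟩ r
      rw [hwt]
      split_ifs with hr
      · subst hr
        by_contra hc
        exact h2 ((key x h1 _).1 (not_lt.1 hc))
      · simpa using h1 r
  have hw1 : ∀ i ∈ J, 1 ≤ w i := fun i hi => by have := hw i hi; omega
  have hw01 : 1 ≤ w0 := by omega
  let F : Finset (Finset (Fin n) × Option (Finset (Fin n))) := Finset.univ.filter (adm k J w w0)
  have hF : ∀ α, α ∈ F ↔ adm k J w w0 α := fun α => by simp [F]
  have e : XX k (insert a J) w w0 = XX k J w w0 \ ⋃ α ∈ F, LL a α := by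
    ext x
    rw [hX, Set.mem_sdiff]
    refine and_congr_right (fun hx => not_congr ?_)
    simp only [Set.mem_iUnion, exists_prop]
    constructor
    · intro h
      exact ⟨_, (hF _).2 (piece_mem h).1, (piece_mem h).2⟩
    · rintro ⟨α, hα, hxα⟩
      exact (piece_eq hk hw1 hw01 hx ((hF _).1 hα) hxα).2
  have hY : IsOpen (XX k J w w0) := isOpen_XX (by omega) _ _ _
  have g1 : Good (k - 2) 1 (XX k J w w0) (XX k (insert a J) w w0) := by
    rw [e]
    refine Good.finset hY F (LL a) (fun α _ => LL_closed a α) ?_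
      (fun α hα => piece_good hk ha hw hw0 ih ((hF _).1 hα))
    intro α hα β hβ hne
    rw [Set.eq_empty_iff_forall_notMem]
    rintro x ⟨⟨hx, hxα⟩, hxβ⟩
    apply hne
    rw [(piece_eq hk hw1 hw01 hx ((hF _).1 hα) hxα).1, (piece_eq hk hw1 hw01 hx ((hF _).1 hβ) hxβ).1]
  refine Good.step (fun x hx => ((hX x).1 hx).1) (ih J w w0 le_rfl hw hw0) g1
    (moveH a ⟨fun x => 1 + ∑ i, |x i| - x a, by fun_prop⟩) (moveH_zero _ _)
    (fun x hx t _ _ => XX_update ha hx _) ?_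
  intro x hx
  rw [moveH_apply, hX]
  refine ⟨XX_update ha hx _, ?_⟩
  rw [wt_update ha, Function.update_self]
  simp only [ContinuousMap.coe_mk, one_mul, add_sub_cancel]
  have hpos : 0 ≤ ∑ i, |x i| := Finset.sum_nonneg (fun i _ => abs_nonneg _)
  rw [abs_of_pos (by linarith), wt, if_neg (by linarith), Finset.sum_eq_zero]
  · omega
  · intro i hi
    rw [if_neg]
    have := Finset.single_le_sum (f := fun i => |x i|) (fun i _ => abs_nonneg _) (Finset.mem_univ i)
    linarith

theorem good_XX {k : ℕ} (hk : 3 ≤ k) : ∀ (m : ℕ) (J : Finset (Fin n)) (w : Fin n → ℕ) (w0 : ℕ), J.card ≤ m →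
      (∀ i ∈ J, w i = 1 ∨ w i = k - 1) → (w0 = 1 ∨ w0 = k - 1) → Good (k - 2) 0 (XX k J w w0) ∅ := by
  classical
  have base : ∀ (w : Fin n → ℕ) (w0 : ℕ), (w0 = 1 ∨ w0 = k - 1) → Good (k - 2) 0 (XX k ∅ w w0) ∅ := by
    intro w w0 hw0
    have : XX k (∅ : Finset (Fin n)) w w0 = Set.univ := by
      rw [Set.eq_univ_iff_forall]
      intro x r
      rw [wt, Finset.sum_empty]
      split_ifs <;> omega
    rw [this]
    exact Good.base _ 0 ⟨fun p => (1 - p.2) • p.1, by fun_prop⟩ (fun x => by simp) (fun x => by simp)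
  intro m
  induction m with
  | zero =>
    intro J w w0 hJ hw hw0
    have : J = ∅ := by simpa using hJ
    rw [this]
    exact base w w0 hw0
  | succ m ih =>
    intro J w w0 hJ hw hw0
    rcases J.eq_empty_or_nonempty with rfl | ⟨b, hb⟩
    · exact base w w0 hw0
    by_cases h1 : ∃ a ∈ J, w a = 1
    · obtain ⟨a, ha, hwa⟩ := h1
      have hc := Finset.card_erase_add_one ha
      rw [← Finset.insert_erase ha]
      refine good_step hk (Finset.notMem_erase a J) (fun i hi => hw i (Finset.mem_of_mem_erase hi)) hw0 ?_ ?_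
      · intro x hx r
        have := hx r
        omega
      · intro J' w' w0' hJ'
        exact ih J' w' w0' (by omega)
    · have hall : ∀ i ∈ J, w i = k - 1 := fun i hi => (hw i hi).resolve_left (fun h => h1 ⟨i, hi, h⟩)
      have hsum : ∀ K ⊆ J, ∀ (x : Fin n → ℝ) (r : ℝ), (∑ i ∈ K, if |x i| = r then w i else 0) =
          (K.filter (fun i => |x i| = r)).card * (k - 1) := by
        intro K hK x r
        rw [← Finset.sum_filter, Finset.sum_congr rfl (fun i hi =>
          hall i (hK (Finset.mem_of_mem_filter i hi)))]
        simp
      have hmul : ∀ c : ℕ, c = 0 ∨ c = 1 ∨ 2 * (k - 1) ≤ c * (k - 1) := by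
        intro c
        rcases c with _ | _ | c
        · simp
        · simp
        · exact Or.inr (Or.inr (Nat.mul_le_mul_right _ (by omega)))
      have e : XX k J w w0 = XX k J w (k - 1) := by
        ext x
        refine forall_congr' (fun r => ?_)
        rw [wt, wt, hsum J subset_rfl]
        rcases hmul (J.filter (fun i => |x i| = r)).card with h | h | h
        · rw [h]; split_ifs <;> omega
        · rw [h]; split_ifs <;> omega
        · split_ifs <;> omega
      rw [e, ← Finset.insert_erase hb]
      have hc := Finset.card_erase_add_one hb
      refine good_step hk (Finset.notMem_erase b J) (fun i hi => hw i (Finset.mem_of_mem_erase hi))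
        (Or.inr rfl) ?_ ?_
      · intro x hx r
        have h2 := hx r
        rw [wt, hsum _ (Finset.erase_subset _ _)] at h2 ⊢
        rw [hall b hb]
        rcases hmul ((J.erase b).filter (fun i => |x i| = r)).card with h | h | h
        · rw [h] at h2 ⊢; split_ifs at h2 ⊢ <;> omega
        · rw [h] at h2 ⊢; split_ifs at h2 ⊢ <;> omega
        · split_ifs at h2 ⊢ <;> omega
      · intro J' w' w0' hJ'
        exact ih J' w' w0' (by omega)

end TB

namespace TB
open Cvx

theorem bdL_ofFn {K : Type} : ∀ (m : ℕ) (w : Fin (m + 1) → K), bdL (List.ofFn w) =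
    ∑ j : Fin (m + 1), ((-1 : ℤ) ^ (j : ℕ)) • bs (List.ofFn (fun i => w (j.succAbove i))) := by
  intro m
  induction m with
  | zero =>
    intro w
    simp [bdL]
  | succ m ih =>
    intro w
    rw [List.ofFn_succ, bdL, ih, Fin.sum_univ_succ (n := m + 1), map_sum, sub_eq_add_neg, ← Finset.sum_neg_distrib]
    congr 1
    · simp
    · refine Finset.sum_congr rfl (fun j _ => ?_)
      rw [map_smul, cone_bs, List.ofFn_succ (f := fun i => w (j.succ.succAbove i))]
      simp [pow_succ]

theorem dS_simplex {E : Type} [TopologicalSpace E] (m : ℕ) (σ : C(Sx (m + 1), E)) :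
    dS (bs (⟨m + 1, σ⟩ : SS E)) = ∑ j : Fin (m + 1), ((-1 : ℤ) ^ (j : ℕ)) •
      bs (⟨m, σ.comp (combS fun i => vert (j.succAbove i))⟩ : SS E) := by
  rw [dS_bs]
  show re σ (bdL (List.ofFn vert)) = _
  rw [bdL_ofFn, map_sum]
  refine Finset.sum_congr rfl (fun j _ => ?_)
  rw [map_smul, re_bs, reL_ofFn]
  rfl

theorem combS_map {m n : ℕ} (f : Fin m → Fin n) (t : Sx m) :
    combS (fun i => vert (f i)) t = stdSimplex.map f t := by
  apply Subtype.ext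
  ext j
  show (combS (fun i => vert (f i)) t).1 j = (stdSimplex.map f t) j
  rw [stdSimplex.map_coe, FunOnFinite.linearMap_apply_apply, combS_val]
  simp only [Finset.sum_apply, Pi.smul_apply, vert, smul_eq_mul, Pi.single_apply, mul_ite, mul_one, mul_zero]
  rw [Finset.sum_filter]
  refine Finset.sum_congr rfl (fun i _ => ?_)
  simp only [eq_comm]
  rfl

theorem sc_elt {R : Type} [Ring R] (S : ShortComplex (ModuleCat R)) (x : S.homology) :
    ∃ z : S.X₂, S.g.hom z = 0 ∧ ∀ m : R, m • x = 0 ↔ ∃ y : S.X₁, S.f.hom y = m • z := by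
  let e : S.homology ≅ ModuleCat.of R (LinearMap.ker S.g.hom ⧸ LinearMap.range S.moduleCatToCycles) :=
    S.moduleCatHomologyIso
  obtain ⟨⟨z, hz⟩, hzx⟩ := Submodule.Quotient.mk_surjective _ (e.toLinearEquiv x)
  refine ⟨z, hz, fun m => ?_⟩
  have h1 : m • x = 0 ↔ m • (e.toLinearEquiv x) = 0 := by
    rw [← map_smul, LinearEquiv.map_eq_zero_iff]
  rw [h1, ← hzx, ← Submodule.Quotient.mk_smul, Submodule.Quotient.mk_eq_zero, LinearMap.mem_range]
  refine exists_congr (fun y => ?_)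
  rw [Subtype.ext_iff]
  rfl

theorem sc_eltZ (S : ShortComplex (ModuleCat ℤ)) (x : S.homology) :
    ∃ z : S.X₂, S.g.hom z = 0 ∧ ∀ m : ℤ, m • x = 0 ↔ ∃ y : S.X₁, S.f.hom y = m • z := by
  obtain ⟨z, hz, h⟩ := sc_elt S x
  refine ⟨z, hz, fun m => ?_⟩
  rw [← int_smul_eq_zsmul S.homology.isModule, ← int_smul_eq_zsmul S.X₂.isModule]
  exact h m

theorem homology_elt (K : ChainComplex (ModuleCat ℤ) ℕ) (i : ℕ) (x : K.homology i) :
    ∃ z : K.X i, (∀ j, (K.d i j).hom z = 0) ∧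
      ∀ m : ℤ, m • x = 0 ↔ ∃ y : K.X (i + 1), (K.d (i + 1) i).hom y = m • z := by
  obtain ⟨z, hz, hx⟩ := sc_eltZ (K.sc i) x
  refine ⟨z, fun j => ?_, fun m => (hx m).trans ?_⟩
  · by_cases h : (ComplexShape.down ℕ).next i = j
    · subst h; exact hz
    · have : K.d i j = 0 := by
        apply K.shape
        intro hr
        exact h ((ComplexShape.down ℕ).next_eq' hr)
      rw [this]; rfl
  · have h2 : ∀ j, (ComplexShape.down ℕ).prev i = j →
      ((∃ y : K.X ((ComplexShape.down ℕ).prev i), (K.d ((ComplexShape.down ℕ).prev i) i).hom y = m • z) ↔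
      ∃ y : K.X j, (K.d j i).hom y = m • z) := by
      rintro _ rfl
      rfl
    exact h2 _ (by simp)

theorem objD_apply (Y : SimplicialObject (ModuleCat ℤ)) (i : ℕ) (x) :
    (AlgebraicTopology.AlternatingFaceMapComplex.objD Y i).hom x =
      ∑ j : Fin (i + 2), ((-1 : ℤ) ^ (j : ℕ)) • (Y.δ j).hom x := by
  rw [AlgebraicTopology.AlternatingFaceMapComplex.objD, ModuleCat.hom_sum, LinearMap.sum_apply]
  refine Finset.sum_congr rfl (fun j _ => ?_)
  rw [ModuleCat.hom_zsmul]
  rfl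

section theta
variable {E : Type} [TopologicalSpace E] (X : Set E)

/-- singular simplices of the subspace as simplices of the ambient space -/
noncomputable def thS (i : ℕ) (σ : (TopCat.toSSet.obj (TopCat.of X)).obj (Opposite.op (SimplexCategory.mk i))) :
    SS E := ⟨i + 1, (ContinuousMap.mk (Subtype.val : X → E) continuous_subtype_val).comp
      ((TopCat.of X).toSSetObjEquiv _ σ)⟩

theorem thS_inj (i : ℕ) : Function.Injective (thS X i) := by
  intro a b h
  rw [thS, thS] at h
  have h2 := eq_of_heq (Sigma.mk.inj h).2
  apply ((TopCat.of X).toSSetObjEquiv _).injective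
  ext t
  exact DFunLike.congr_fun h2 t

theorem thS_surj (i : ℕ) (σ : SS E) (h1 : σ.1 = i + 1) (h2 : Set.range σ.2 ⊆ X) : ∃ a, thS X i a = σ := by
  obtain ⟨m, σ⟩ := σ
  have h1 : m = i + 1 := h1
  subst h1
  let τ : C(Sx (i + 1), X) := ⟨fun t => ⟨σ t, h2 ⟨t, rfl⟩⟩, by fun_prop⟩
  refine ⟨((TopCat.of X).toSSetObjEquiv (Opposite.op (SimplexCategory.mk i))).symm τ, ?_⟩
  rw [thS, Equiv.apply_symm_apply]
  rfl

noncomputable def th (i : ℕ) : (singularChainComplex (TopCat.of X)).X i ⟶ ModuleCat.of ℤ (Ch E) :=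
  ModuleCat.freeDesc (↾ (fun σ => (bs (thS X i σ) : Ch E)))

noncomputable abbrev mk (i : ℕ) (σ : (TopCat.toSSet.obj (TopCat.of X)).obj (Opposite.op (SimplexCategory.mk i))) :
    (singularChainComplex (TopCat.of X)).X i := ModuleCat.freeMk σ

theorem th_mk (i : ℕ) (σ) : (th X i).hom (mk X i σ) = bs (thS X i σ) :=
  ModuleCat.freeDesc_apply _ _

theorem ch_ext {M : Type} [AddCommGroup M] (i : ℕ) (f g : (singularChainComplex (TopCat.of X)).X i →ₗ[ℤ] M)
    (h : ∀ σ, f (mk X i σ) = g (mk X i σ)) (x) : f x = g x := by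
  have : ModuleCat.ofHom f = ModuleCat.ofHom g := ModuleCat.free_hom_ext h
  exact LinearMap.congr_fun (ModuleCat.hom_ext_iff.1 this) x

open Classical in
theorem th_inj (i : ℕ) : Function.Injective (th X i).hom := by
  let π : Ch E →ₗ[ℤ] (singularChainComplex (TopCat.of X)).X i :=
    lin (fun a => if h : ∃ t, thS X i t = a then mk X i h.choose else 0)
  apply Function.LeftInverse.injective (g := π)
  intro x
  refine ch_ext X i (π ∘ₗ (th X i).hom) LinearMap.id (fun σ => ?_) x
  rw [LinearMap.comp_apply, th_mk, lin_single]
  have h : ∃ t, thS X i t = thS X i σ := ⟨σ, rfl⟩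
  rw [dif_pos h, thS_inj X i h.choose_spec]
  rfl

theorem th_surj (i : ℕ) {z : Ch E} (h1 : z ∈ hom E (i + 1)) (h2 : z ∈ sub X) :
    ∃ y, (th X i).hom y = z := by
  have h3 : z ∈ hom E (i + 1) ⊓ sub X := ⟨h1, h2⟩
  rw [sub, hom, ← Finsupp.supported_inter] at h3
  refine supp_induct LinearMap.id _ (LinearMap.range (th X i).hom) (fun σ hσ => ?_) h3
  obtain ⟨a, rfl⟩ := thS_surj X i σ hσ.1 hσ.2
  exact ⟨mk X i a, th_mk X i a⟩

theorem th_mem (i : ℕ) (x) : (th X i).hom x ∈ hom E (i + 1) ⊓ sub X := by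
  have := ch_ext X i ((hom E (i + 1) ⊓ sub X).mkQ ∘ₗ (th X i).hom) 0 (fun σ => ?_) x
  · exact (Submodule.Quotient.mk_eq_zero _).1 this
  · rw [LinearMap.comp_apply, th_mk]
    refine (Submodule.Quotient.mk_eq_zero _).2 ⟨?_, bs_sub ?_⟩
    · exact Finsupp.single_mem_supported _ _ rfl
    · rintro _ ⟨t, rfl⟩
      exact Subtype.property _

theorem d_mk (i : ℕ) (σ) : ((singularChainComplex (TopCat.of X)).d (i + 1) i).hom (mk X (i + 1) σ) =
    ∑ j : Fin (i + 2), ((-1 : ℤ) ^ (j : ℕ)) • mk X i ((TopCat.toSSet.obj (TopCat.of X)).δ j σ) := by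
  have : (singularChainComplex (TopCat.of X)).d (i + 1) i =
      AlgebraicTopology.AlternatingFaceMapComplex.objD
        (((SimplicialObject.whiskering _ _).obj (ModuleCat.free ℤ)).obj (TopCat.toSSet.obj (TopCat.of X))) i :=
    AlgebraicTopology.alternatingFaceMapComplex_obj_d _ _
  rw [this]
  refine (objD_apply _ i _).trans ?_
  refine Finset.sum_congr rfl (fun j _ => ?_)
  refine congrArg (fun u => ((-1 : ℤ) ^ (j : ℕ)) • u) ?_
  exact ModuleCat.free_map_apply _ _

theorem th_d (i : ℕ) (x) : (th X i).hom (((singularChainComplex (TopCat.of X)).d (i + 1) i).hom x) =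
    dS ((th X (i + 1)).hom x) := by
  refine ch_ext X (i + 1) ((th X i).hom ∘ₗ ((singularChainComplex (TopCat.of X)).d (i + 1) i).hom)
    (dS ∘ₗ (th X (i + 1)).hom) (fun σ => ?_) x
  rw [LinearMap.comp_apply, LinearMap.comp_apply, d_mk, th_mk, map_sum]
  rw [thS, dS_simplex]
  refine Finset.sum_congr rfl (fun j _ => ?_)
  rw [map_smul, th_mk]
  rw [thS]
  congr 3
  refine ContinuousMap.ext (fun t => ?_)
  rw [ContinuousMap.comp_apply, ContinuousMap.comp_apply, ContinuousMap.comp_apply, combS_map]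
  rfl

theorem homology_good (d : ℕ) (hg : Good d 0 X ∅) (i : ℕ) (x : singularHomology (TopCat.of X) i) :
    (∀ m : ℤ, m ≠ 0 → m • x = 0 → x = 0) ∧ ((¬ ∃ t, i = 0 + t * d) → x = 0) := by
  obtain ⟨z, hz, hx⟩ := homology_elt (singularChainComplex (TopCat.of X)) i x
  have hzm := th_mem X i z
  have hd : dS ((th X i).hom z) ∈ sub (∅ : Set E) := by
    cases i with
    | zero => exact hom_zero_sub (dS_hom hzm.1)
    | succ i =>
      rw [← th_d, hz i, map_zero]
      exact Submodule.zero_mem _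
  have key : ∀ m : ℤ, m • x = 0 ↔ m • (th X i).hom z ∈ Bd X ∅ := by
    intro m
    refine (hx m).trans ⟨?_, fun h => ?_⟩
    · rintro ⟨y, hy⟩
      refine mem_Bd.2 ⟨(th X (i + 1)).hom y, (th_mem X (i + 1) y).2, 0, Submodule.zero_mem _, ?_⟩
      rw [← th_d, hy, map_zsmul, add_zero]
    · obtain ⟨y, hy, a, ha, hyi, hai, h⟩ := mem_Bd_hom (Submodule.smul_mem _ m hzm.1) h
      rw [sub_empty_hom ha hai, add_zero] at h
      obtain ⟨y, rfl⟩ := th_surj X (i + 1) hyi hy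
      refine ⟨y, th_inj X i ?_⟩
      rw [th_d, ← h, map_zsmul]
  obtain ⟨g1, g2⟩ := hg i _ hzm.1 hzm.2 hd
  have k1 : x = 0 ↔ (th X i).hom z ∈ Bd X ∅ := by
    have := key 1
    rwa [one_smul, one_smul] at this
  exact ⟨fun m hm h => k1.2 (g1 m hm ((key m).1 h)), fun h => k1.2 (g2 h)⟩

end theta
end TB

theorem homology_of_typeB_complement (n k : ℕ) (hk : 3 ≤ k) (hkn : k ≤ n) :
    (∀ i : ℕ, ∀ c : ℤ, c ≠ 0 →
        ∀ x : (singularHomology (TopCat.of (typeBComplement n k)) i), c • x = 0 → x = 0) ∧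
    (∀ i : ℕ, 1 ≤ i → (¬ ∃ t : ℕ, 1 ≤ t ∧ i = t * (k - 2)) →
        Subsingleton (singularHomology (TopCat.of (typeBComplement n k)) i)) := by
  have hg : TB.Good (k - 2) 0 (typeBComplement n k) ∅ := by
    have h := TB.good_XX (n := n) hk n Finset.univ (fun _ => 1) 1 (by simp)
      (fun _ _ => Or.inl rfl) (Or.inl rfl)
    rw [← TB.typeB_eq hk] at h
    exact h
  refine ⟨fun i c hc x hx => (TB.homology_good _ _ hg i x).1 c hc hx, fun i hi ht => ?_⟩
  have key : ∀ x : singularHomology (TopCat.of (typeBComplement n k)) i, x = 0 := by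
    intro x
    refine (TB.homology_good _ _ hg i x).2 ?_
    rintro ⟨t, h⟩
    rw [zero_add] at h
    refine ht ⟨t, ?_, h⟩
    rcases Nat.eq_zero_or_pos t with rfl | h'
    · omega
    · exact h'
  exact ⟨fun a b => by rw [key a, key b]⟩
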